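/- arXiv:1307.4948 — 4 statements merged into one kernel-verified Lean document; each statement's English description precedes it below -/
import Mathlib

section
/- Boundedness of the Riesz potential on Lorentz spaces: let n ≥ 1, 1 ≤ p < ∞, 1 ≤ q ≤ ∞, 0 < α < n/p, and define 1/r = 1/p − α/n. Let A denote the Lebesgue measure of the unit ball in ℝⁿ. If f ∈ L^{p,q}(ℝⁿ), then the Riesz potential I_α f(x) = ∫_{ℝⁿ} |x−y|^{α−n} f(y) dy belongs to L^{r,q}(ℝⁿ) and ‖I_α f‖_{r,q} ≤ (3 r n / α) A^{(n−α)/n} ‖f‖_{p,q}. -/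
open MeasureTheory Set
open scoped ENNReal

/-- Distribution function: `μ {x : |f x| > s}`. -/
noncomputable def distrib {X : Type*} [MeasurableSpace X] (μ : Measure X)
    (f : X → ℝ) (s : ℝ) : ℝ≥0∞ :=
  μ {x | s < |f x|}

/-- Decreasing rearrangement: `f*(t) = inf {s > 0 : λ_f(s) ≤ t}`. -/
noncomputable def rearr {X : Type*} [MeasurableSpace X] (μ : Measure X)
    (f : X → ℝ) (t : ℝ) : ℝ≥0∞ :=
  ⨅ (s : ℝ) (_ : 0 < s ∧ distrib μ f s ≤ ENNReal.ofReal t), ENNReal.ofReal s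

/-- Maximal function `f**(t) = (1/t) ∫₀ᵗ f*(u) du`. -/
noncomputable def maxFn {X : Type*} [MeasurableSpace X] (μ : Measure X)
    (f : X → ℝ) (t : ℝ) : ℝ≥0∞ :=
  (ENNReal.ofReal t)⁻¹ * ∫⁻ u in Set.Ioc (0:ℝ) t, rearr μ f u

/-- Lorentz norm `‖f‖_{p,q}`; for `q = ∞` it is `sup_{t>0} t^{1/p} f**(t)`. -/
noncomputable def lorentzNorm {X : Type*} [MeasurableSpace X] (μ : Measure X)
    (f : X → ℝ) (p : ℝ) (q : ℝ≥0∞) : ℝ≥0∞ :=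
  if q = ⊤ then ⨆ (t : ℝ) (_ : 0 < t), ENNReal.ofReal t ^ (1/p) * maxFn μ f t
  else (∫⁻ t in Set.Ioi (0:ℝ),
      (ENNReal.ofReal t ^ (1/p) * maxFn μ f t) ^ q.toReal * (ENNReal.ofReal t)⁻¹) ^ (1 / q.toReal)

/-- Convolution on ℝⁿ: `(f ∗ g)(x) = ∫ f(x-y) g(y) dy`. -/
noncomputable def conv {n : ℕ} (f g : EuclideanSpace ℝ (Fin n) → ℝ)
    (x : EuclideanSpace ℝ (Fin n)) : ℝ :=
  ∫ y, f (x - y) * g y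

/-- `‖f‖_p = (∫ |f|^p dμ)^{1/p}`. -/
noncomputable def lpNorm {X : Type*} [MeasurableSpace X] (μ : Measure X)
    (f : X → ℝ) (p : ℝ) : ℝ≥0∞ :=
  (∫⁻ x, ENNReal.ofReal |f x| ^ p ∂μ) ^ (1/p)

/-- Riesz potential `I_α f(x) = ∫ |x-y|^{α-n} f(y) dy` on ℝⁿ. -/
noncomputable def riesz (n : ℕ) (α : ℝ) (f : EuclideanSpace ℝ (Fin n) → ℝ)
    (x : EuclideanSpace ℝ (Fin n)) : ℝ :=
  ∫ y, ‖x - y‖ ^ (α - (n:ℝ)) * f y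

/-- The value `1` when `a < b` and `0` otherwise. -/
noncomputable def ltInd (a b : ℝ≥0∞) : ℝ≥0∞ := if a < b then 1 else 0

lemma Measurable.ltInd {Y : Type*} [MeasurableSpace Y] {f g : Y → ℝ≥0∞}
    (hf : Measurable f) (hg : Measurable g) : Measurable fun y => ltInd (f y) (g y) :=
  Measurable.ite (measurableSet_lt hf hg) measurable_const measurable_const

lemma lintegral_ltInd {Y : Type*} [MeasurableSpace Y] (μ : Measure Y) {f g : Y → ℝ≥0∞}
    (hf : Measurable f) (hg : Measurable g) :
    ∫⁻ y, ltInd (f y) (g y) ∂μ = μ {y | f y < g y} := by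
  rw [← lintegral_indicator_one (measurableSet_lt hf hg)]
  refine lintegral_congr fun y => ?_
  by_cases h : f y < g y <;> simp [ltInd, h]

lemma lintegral_ltInd_ofReal (c : ℝ≥0∞) :
    ∫⁻ s in Ioi (0:ℝ), ltInd (ENNReal.ofReal s) c = c := by
  rw [lintegral_ltInd _ (by fun_prop) (by fun_prop),
    Measure.restrict_apply (measurableSet_lt (by fun_prop) (by fun_prop))]
  rcases eq_or_ne c ⊤ with rfl | hc
  · simp
  · have : {y : ℝ | ENNReal.ofReal y < c} ∩ Ioi 0 = Ioo 0 c.toReal := by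
      ext y
      simp only [mem_inter_iff, mem_ofPred_eq, mem_Ioi, mem_Ioo]
      constructor
      · rintro ⟨h1, h2⟩
        exact ⟨h2, (ENNReal.ofReal_lt_iff_lt_toReal h2.le hc).1 h1⟩
      · rintro ⟨h1, h2⟩
        exact ⟨(ENNReal.ofReal_lt_iff_lt_toReal h1.le hc).2 h2, h1⟩
    rw [this, Real.volume_Ioo, sub_zero, ENNReal.ofReal_toReal hc]

section Rearrangement

variable {X : Type*} [MeasurableSpace X] (μ : Measure X) (f : X → ℝ)

lemma distrib_antitone : Antitone (distrib μ f) :=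
  fun _ _ hst => measure_mono fun _ hx => lt_of_le_of_lt hst hx

lemma measurable_distrib : Measurable (distrib μ f) := (distrib_antitone μ f).measurable

lemma rearr_antitone : Antitone (rearr μ f) := fun _ _ hst =>
  iInf_mono fun _ => iInf_mono' fun h =>
    ⟨⟨h.1, h.2.trans (ENNReal.ofReal_le_ofReal hst)⟩, le_rfl⟩

lemma measurable_rearr : Measurable (rearr μ f) := (rearr_antitone μ f).measurable

lemma rearr_eq_lintegral (u : ℝ) :
    rearr μ f u = ∫⁻ s in Ioi (0:ℝ), ltInd (ENNReal.ofReal u) (distrib μ f s) := by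
  have hm := measurable_distrib μ f
  rw [lintegral_ltInd _ (by fun_prop) hm,
    Measure.restrict_apply (measurableSet_lt (by fun_prop) hm)]
  apply le_antisymm
  · refine le_of_forall_gt fun c hc => ?_
    obtain ⟨s, hs1, hs2⟩ := ENNReal.lt_iff_exists_nnreal_btwn.1 hc
    have hs0 : (0:ℝ) < s := by
      rcases eq_or_lt_of_le s.2 with h | h
      · have : s = 0 := by ext; exact h.symm
        simp [this] at hs1
      · exact h
    refine lt_of_le_of_lt ?_ hs2
    refine iInf₂_le_of_le (s:ℝ) ⟨hs0, ?_⟩ (by simp)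
    by_contra! hlt
    refine absurd hs1 (not_lt.2 ?_)
    calc (s : ℝ≥0∞) = volume (Ioc 0 (s:ℝ)) := by simp
      _ ≤ volume ({s : ℝ | ENNReal.ofReal u < distrib μ f s} ∩ Ioi 0) := measure_mono fun y hy =>
        ⟨hlt.trans_le (distrib_antitone μ f hy.2), hy.1⟩
  · refine le_iInf₂ fun s hs => ?_
    calc _ ≤ volume (Ioo 0 s) := measure_mono fun y hy =>
            ⟨hy.2, by
              by_contra! h
              exact absurd hy.1 (not_lt.2 ((distrib_antitone μ f h).trans hs.2))⟩
      _ = _ := by simp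

lemma measurable_maxFn : Measurable (maxFn μ f) := by
  refine Measurable.mul (by fun_prop) (Monotone.measurable fun s t hst => ?_)
  exact lintegral_mono_set (Ioc_subset_Ioc_right hst)

lemma rearr_le_maxFn {t : ℝ} (ht : 0 < t) : rearr μ f t ≤ maxFn μ f t := by
  have h0 : ENNReal.ofReal t ≠ 0 := by simpa using ht
  calc rearr μ f t = (ENNReal.ofReal t)⁻¹ * (rearr μ f t * ENNReal.ofReal t) := by
        rw [mul_comm (rearr μ f t), ← mul_assoc,
          ENNReal.inv_mul_cancel h0 ENNReal.ofReal_ne_top, one_mul]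
    _ = (ENNReal.ofReal t)⁻¹ * ∫⁻ _ in Ioc (0:ℝ) t, rearr μ f t := by simp
    _ ≤ _ := by
        refine mul_le_mul_right ?_ _
        exact setLIntegral_mono (measurable_rearr μ f) fun u hu => rearr_antitone μ f hu.2

variable {μ f}

/-- If `|h| ≤ g + M`, then the integral of the rearrangement of `h` over `(0, t]` is at most
`∫ g + t M`. -/
lemma lintegral_rearr_le [SFinite μ] {h : X → ℝ} {g : X → ℝ≥0∞} (hg : Measurable g) (M : ℝ≥0∞)
    (hgM : ∀ x, ENNReal.ofReal |h x| ≤ g x + M) (t : ℝ) :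
    ∫⁻ u in Ioc (0:ℝ) t, rearr μ h u ≤ ∫⁻ x, g x ∂μ + ENNReal.ofReal t * M := by
  have hm := measurable_distrib μ h
  have key : ∀ s : ℝ, ∫⁻ u in Ioc (0:ℝ) t, ltInd (ENNReal.ofReal u) (distrib μ h s) ≤
      distrib μ h s := fun s =>
    calc _ ≤ ∫⁻ u in Ioi (0:ℝ), ltInd (ENNReal.ofReal u) (distrib μ h s) :=
          lintegral_mono_set Ioc_subset_Ioi_self
      _ = _ := lintegral_ltInd_ofReal _
  have key' : ∀ s : ℝ, ∫⁻ u in Ioc (0:ℝ) t, ltInd (ENNReal.ofReal u) (distrib μ h s) ≤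
      ENNReal.ofReal t := fun s =>
    calc _ ≤ ∫⁻ u in Ioc (0:ℝ) t, 1 := lintegral_mono fun u => by
            unfold ltInd; split_ifs <;> simp
      _ = _ := by simp
  rcases eq_or_ne M ⊤ with rfl | hM
  · rcases le_or_gt t 0 with ht | ht
    · simp [Ioc_eq_empty (not_lt.2 ht)]
    · have : ENNReal.ofReal t ≠ 0 := by simpa using ht
      simp [ENNReal.mul_top this]
  lift M to NNReal using hM
  have hd : ∀ s : ℝ, 0 < s → distrib μ h (M + s) ≤ μ {x | ENNReal.ofReal s < g x} :=
    fun s hs => measure_mono fun x hx => by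
      have h1 : ENNReal.ofReal (M + s) < g x + M :=
        lt_of_lt_of_le ((ENNReal.ofReal_lt_ofReal_iff (by
          have : (0:ℝ) ≤ M := M.2
          have : (M:ℝ) + s < |h x| := hx
          linarith)).2 hx) (hgM x)
      rw [add_comm (M:ℝ), ENNReal.ofReal_add hs.le M.coe_nonneg, ENNReal.ofReal_coe_nnreal] at h1
      exact lt_of_add_lt_add_right h1
  have hmeas : Measurable (Function.uncurry fun (u s : ℝ) =>
      ltInd (ENNReal.ofReal u) (distrib μ h s)) :=
    Measurable.ltInd (by fun_prop) (hm.comp measurable_snd)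
  calc ∫⁻ u in Ioc (0:ℝ) t, rearr μ h u
      = ∫⁻ u in Ioc (0:ℝ) t, ∫⁻ s in Ioi (0:ℝ), ltInd (ENNReal.ofReal u) (distrib μ h s) := by
        simp only [rearr_eq_lintegral]
    _ = ∫⁻ s in Ioi (0:ℝ), ∫⁻ u in Ioc (0:ℝ) t, ltInd (ENNReal.ofReal u) (distrib μ h s) :=
        lintegral_lintegral_swap hmeas.aemeasurable
    _ ≤ (∫⁻ s in Ioc (0:ℝ) M, ENNReal.ofReal t) + ∫⁻ s in Ioi (M:ℝ), distrib μ h s := by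
        rw [← Ioc_union_Ioi_eq_Ioi M.2, lintegral_union measurableSet_Ioi
          (Set.Ioc_disjoint_Ioi le_rfl)]
        exact add_le_add (lintegral_mono fun s => key' s) (lintegral_mono fun s => key s)
    _ ≤ ENNReal.ofReal t * M + ∫⁻ x, g x ∂μ := by
        gcongr
        · simp
        · calc ∫⁻ s in Ioi (M:ℝ), distrib μ h s
              = ∫⁻ s in Ioi (0:ℝ), distrib μ h (M + s) := by
                rw [← lintegral_indicator measurableSet_Ioi, ← lintegral_indicator measurableSet_Ioi,
                  ← lintegral_add_left_eq_self _ (M:ℝ)]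
                congr 1; ext s
                simp [indicator]
            _ ≤ ∫⁻ s in Ioi (0:ℝ), μ {x | ENNReal.ofReal s < g x} :=
                setLIntegral_mono' measurableSet_Ioi fun s hs => hd s hs
            _ = ∫⁻ s in Ioi (0:ℝ), ∫⁻ x, ltInd (ENNReal.ofReal s) (g x) ∂μ := by
                congr 1; ext s
                rw [lintegral_ltInd _ measurable_const hg]
            _ = ∫⁻ x, (∫⁻ s in Ioi (0:ℝ), ltInd (ENNReal.ofReal s) (g x)) ∂μ :=
                lintegral_lintegral_swap
                  (Measurable.ltInd (by fun_prop) (hg.comp measurable_snd)).aemeasurable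
            _ = _ := by simp only [lintegral_ltInd_ofReal]
    _ = _ := add_comm _ _

/-- Fubini for the layer-cake representation of a weighted integral of the rearrangement. -/
lemma lintegral_lintegral_ltInd_distrib {w : ℝ → ℝ≥0∞} (hw : Measurable w) :
    ∫⁻ s in Ioi (0:ℝ), ∫⁻ u in Ioi (0:ℝ), ltInd (ENNReal.ofReal u) (distrib μ f s) * w u =
      ∫⁻ u in Ioi (0:ℝ), rearr μ f u * w u := by
  have hm := measurable_distrib μ f
  rw [lintegral_lintegral_swap]
  · congr 1; ext u
    rw [lintegral_mul_const _ (Measurable.ltInd measurable_const hm), rearr_eq_lintegral]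
  · exact ((Measurable.ltInd (by fun_prop) (hm.comp measurable_fst)).mul
      (hw.comp measurable_snd)).aemeasurable

end Rearrangement

section Kernel

lemma mul_ofReal_rpow_le_lintegral {a t : ℝ} (ha : a < 1) (ht : 0 < t) {L : ℝ≥0∞} (hL : L ≠ ⊤) :
    L * ENNReal.ofReal ((max L.toReal t) ^ (a - 1)) ≤
      ∫⁻ u in Ioi (0:ℝ), ltInd (ENNReal.ofReal u) L * ENNReal.ofReal ((max u t) ^ (a - 1)) := by
  calc L * ENNReal.ofReal ((max L.toReal t) ^ (a - 1))
      = ∫⁻ u in Ioi (0:ℝ), ltInd (ENNReal.ofReal u) L *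
          ENNReal.ofReal ((max L.toReal t) ^ (a - 1)) := by
        rw [lintegral_mul_const _ (Measurable.ltInd (by fun_prop) (by fun_prop)),
          lintegral_ltInd_ofReal]
    _ ≤ _ := by
        refine lintegral_mono fun u => ?_
        unfold ltInd
        split_ifs with h
        · have hu : u ≤ L.toReal := ENNReal.ofReal_le_iff_le_toReal hL |>.1 h.le
          simp only [one_mul]
          refine ENNReal.ofReal_le_ofReal (Real.rpow_le_rpow_of_nonpos ?_ ?_ (by linarith))
          · exact lt_max_of_lt_right ht
          · exact max_le_max_right _ hu
        · simp

lemma lintegral_ltInd_top_mul_rpow {a t : ℝ} (ha0 : 0 < a) (ha : a < 1) (ht : 0 < t) :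
    ∫⁻ u in Ioi (0:ℝ), ltInd (ENNReal.ofReal u) ⊤ * ENNReal.ofReal ((max u t) ^ (a - 1)) = ⊤ := by
  refine ENNReal.eq_top_of_forall_nnreal_le fun N => ?_
  obtain ⟨x, hxN, hxt⟩ := (((tendsto_rpow_atTop ha0).eventually_ge_atTop (N:ℝ)).and
    (Filter.eventually_ge_atTop t)).exists
  have hx : 0 < x := ht.trans_le hxt
  calc (N : ℝ≥0∞) = ENNReal.ofReal N := by simp
    _ ≤ ENNReal.ofReal (x ^ a) := ENNReal.ofReal_le_ofReal hxN
    _ = ENNReal.ofReal x * ENNReal.ofReal ((max (ENNReal.ofReal x).toReal t) ^ (a - 1)) := by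
        rw [ENNReal.toReal_ofReal hx.le, max_eq_left hxt, ← ENNReal.ofReal_mul hx.le,
          Real.rpow_sub_one hx.ne', mul_div_cancel₀ _ hx.ne']
    _ ≤ _ := mul_ofReal_rpow_le_lintegral ha ht ENNReal.ofReal_ne_top
    _ ≤ _ := by
        refine lintegral_mono fun u => ?_
        gcongr
        unfold ltInd
        split_ifs <;> simp_all

variable {G : Type*} [AddGroup G] [MeasurableSpace G] [MeasurableAdd₂ G] [MeasurableNeg G]
  {μ : Measure G} [μ.IsAddLeftInvariant] [μ.IsNegInvariant]

/-- A kernel `k` is of weak type `(C, a)` when at each scale `t` it splits into an integrable and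
a bounded part whose sizes are controlled by `C * t ^ a`. -/
def WeakKernel (μ : Measure G) (k : G → ℝ≥0∞) (C : ℝ≥0∞) (a : ℝ) : Prop :=
  ∀ t : ℝ, 0 < t → ∃ k₁ : G → ℝ≥0∞, Measurable k₁ ∧ ∃ κ : ℝ≥0∞, (∀ z, k z ≤ k₁ z + κ) ∧
    ∫⁻ z, k₁ z ∂μ + ENNReal.ofReal t * κ ≤ C * ENNReal.ofReal (t ^ a)

lemma WeakKernel.lintegral_ltInd_le {k : G → ℝ≥0∞} {C : ℝ≥0∞} {a : ℝ} (hk : WeakKernel μ k C a)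
    (ha0 : 0 < a) (ha : a < 1) (hC : C ≠ 0) {g : G → ℝ≥0∞} (hg : Measurable g) (s : ℝ≥0∞)
    {t : ℝ} (ht : 0 < t)
    (hts : ENNReal.ofReal t < μ {y | s < g y}) (x : G) :
    ∫⁻ y, k (x - y) * ltInd s (g y) ∂μ ≤
      C * ∫⁻ u in Ioi (0:ℝ), ltInd (ENNReal.ofReal u) (μ {y | s < g y}) *
        ENNReal.ofReal ((max u t) ^ (a - 1)) := by
  set L := μ {y | s < g y} with hLdef
  rcases eq_or_ne L ⊤ with hL | hL
  · rw [hL, lintegral_ltInd_top_mul_rpow ha0 ha ht, ENNReal.mul_top hC]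
    exact le_top
  have htL : t < L.toReal := (ENNReal.ofReal_lt_iff_lt_toReal ht.le hL).1 hts
  have hL0 : 0 < L.toReal := ht.trans htL
  obtain ⟨k₁, hk₁, κ, hle, hint⟩ := hk L.toReal hL0
  rw [ENNReal.ofReal_toReal hL] at hint
  have hm : Measurable fun y => ltInd s (g y) := Measurable.ltInd measurable_const hg
  calc ∫⁻ y, k (x - y) * ltInd s (g y) ∂μ
      ≤ ∫⁻ y, (k₁ (x - y) + κ * ltInd s (g y)) ∂μ := by
        refine lintegral_mono fun y => ?_
        unfold ltInd
        split_ifs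
        · simpa using hle _
        · simp
    _ = ∫⁻ z, k₁ z ∂μ + L * κ := by
        rw [lintegral_add_right _ (hm.const_mul κ), lintegral_const_mul _ hm,
          lintegral_sub_left_eq_self, lintegral_ltInd _ measurable_const hg, mul_comm κ]
    _ ≤ C * ENNReal.ofReal (L.toReal ^ a) := hint
    _ = C * (L * ENNReal.ofReal ((max L.toReal t) ^ (a - 1))) := by
        nth_rw 2 [← ENNReal.ofReal_toReal hL]
        rw [max_eq_left htL.le, ← ENNReal.ofReal_mul hL0.le,
          Real.rpow_sub_one hL0.ne', mul_div_cancel₀ _ hL0.ne']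
    _ ≤ _ := by gcongr; exact mul_ofReal_rpow_le_lintegral ha ht hL

/-- O'Neil's inequality for a weak-type kernel. -/
lemma WeakKernel.lintegral_rearr_le [SFinite μ] [μ.IsAddRightInvariant] {k : G → ℝ≥0∞}
    (hkm : Measurable k) {C : ℝ≥0∞} {a : ℝ}
    (hk : WeakKernel μ k C a) (ha0 : 0 < a) (ha : a < 1) (hC : C ≠ 0)
    {f h : G → ℝ} (hf : Measurable f)
    (hh : ∀ x, ENNReal.ofReal |h x| ≤ ∫⁻ y, k (x - y) * ENNReal.ofReal |f y| ∂μ)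
    {t : ℝ} (ht : 0 < t) :
    ∫⁻ u in Ioc (0:ℝ) t, rearr μ h u ≤ ENNReal.ofReal t *
      (C * ∫⁻ u in Ioi (0:ℝ), rearr μ f u * ENNReal.ofReal ((max u t) ^ (a - 1))) := by
  obtain ⟨k₁, hk₁, κ, hle, hint⟩ := hk t ht
  have hdm := measurable_distrib μ f
  have hfm : Measurable fun y => ENNReal.ofReal |f y| := by fun_prop
  set S : Set ℝ := {s | distrib μ f s ≤ ENNReal.ofReal t} with hS
  have hSm : MeasurableSet S := measurableSet_le hdm measurable_const
  have hInd : Measurable (Function.uncurry fun (y : G) (s : ℝ) =>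
      ltInd (ENNReal.ofReal s) (ENNReal.ofReal |f y|)) :=
    Measurable.ltInd (by fun_prop) (hfm.comp measurable_fst)
  have hdist : ∀ s : ℝ, 0 < s →
      μ {y | ENNReal.ofReal s < ENNReal.ofReal |f y|} = distrib μ f s := fun s hs => by
    unfold distrib
    congr 1; ext y
    exact ENNReal.ofReal_lt_ofReal_iff_of_nonneg hs.le
  set Φ : ℝ → ℝ≥0∞ := fun s => ∫⁻ u in Ioi (0:ℝ), ltInd (ENNReal.ofReal u) (distrib μ f s) *
    ENNReal.ofReal ((max u t) ^ (a - 1)) with hΦ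
  set f₁ : G → ℝ≥0∞ := fun y => ∫⁻ s in Ioi (0:ℝ) ∩ S,
    ltInd (ENNReal.ofReal s) (ENNReal.ofReal |f y|)
  set f₂ : G → ℝ≥0∞ := fun y => ∫⁻ s in Ioi (0:ℝ) \ S,
    ltInd (ENNReal.ofReal s) (ENNReal.ofReal |f y|)
  have hf₁m : Measurable f₁ := hInd.lintegral_prod_right
  have hf₂m : Measurable f₂ := hInd.lintegral_prod_right
  have hsplit : ∀ y, ENNReal.ofReal |f y| = f₁ y + f₂ y := fun y => by
    rw [lintegral_inter_add_sdiff _ _ hSm, lintegral_ltInd_ofReal]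
  have hsub : Measurable fun z : G × G => z.1 - z.2 := by
    simp only [sub_eq_add_neg]; fun_prop
  have hk₁sub : Measurable fun z : G × G => k₁ (z.1 - z.2) := hk₁.comp hsub
  have hsubx : ∀ x : G, Measurable fun y : G => x - y := fun x =>
    hsub.comp (measurable_const.prodMk measurable_id)
  set g : G → ℝ≥0∞ := fun x => ∫⁻ y, k₁ (x - y) * f₁ y ∂μ with hg
  have hgunc : Measurable (Function.uncurry fun x y : G => k₁ (x - y) * f₁ y) :=
    hk₁sub.mul (hf₁m.comp measurable_snd)
  have hgm : Measurable g := hgunc.lintegral_prod_right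
  have hgint : ∫⁻ x, g x ∂μ = (∫⁻ z, k₁ z ∂μ) * ∫⁻ y, f₁ y ∂μ := by
    rw [hg, lintegral_lintegral_swap hgunc.aemeasurable, ← lintegral_const_mul _ hf₁m]
    refine lintegral_congr fun y => ?_
    have hm : Measurable fun x => k₁ (x - y) :=
      hk₁sub.comp (measurable_id.prodMk measurable_const)
    rw [lintegral_mul_const _ hm, lintegral_sub_right_eq_self]
  have hf₁int : ∫⁻ y, f₁ y ∂μ = ∫⁻ s in Ioi (0:ℝ) ∩ S, distrib μ f s := by
    rw [lintegral_lintegral_swap hInd.aemeasurable]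
    refine setLIntegral_congr_fun (measurableSet_Ioi.inter hSm) fun s hs => ?_
    rw [lintegral_ltInd _ measurable_const hfm, hdist s hs.1]
  have hf₂bd : ∀ x, ∫⁻ y, k (x - y) * f₂ y ∂μ ≤ C * ∫⁻ s in Ioi (0:ℝ) \ S, Φ s := fun x => by
    have hΦm : Measurable Φ := Measurable.lintegral_prod_right
      ((Measurable.ltInd (by fun_prop) (hdm.comp measurable_fst)).mul (by fun_prop))
    calc ∫⁻ y, k (x - y) * f₂ y ∂μ
        = ∫⁻ y, (∫⁻ s in Ioi (0:ℝ) \ S,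
            k (x - y) * ltInd (ENNReal.ofReal s) (ENNReal.ofReal |f y|)) ∂μ := by
          refine lintegral_congr fun y => ?_
          rw [lintegral_const_mul _ (Measurable.ltInd (by fun_prop) measurable_const)]
      _ = ∫⁻ s in Ioi (0:ℝ) \ S, ∫⁻ y,
            k (x - y) * ltInd (ENNReal.ofReal s) (ENNReal.ofReal |f y|) ∂μ :=
          lintegral_lintegral_swap
            (((hkm.comp (hsubx x)).comp measurable_fst).mul hInd).aemeasurable
      _ ≤ ∫⁻ s in Ioi (0:ℝ) \ S, C * Φ s := by
          refine setLIntegral_mono' (measurableSet_Ioi.diff hSm) fun s hs => ?_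
          have hs' : ENNReal.ofReal t < distrib μ f s := not_le.1 hs.2
          have := hk.lintegral_ltInd_le ha0 ha hC hfm (ENNReal.ofReal s) ht
            (by rwa [hdist s hs.1]) x
          rwa [hdist s hs.1] at this
      _ = _ := lintegral_const_mul _ hΦm
  have hbound : ∀ x, ENNReal.ofReal |h x| ≤
      g x + (κ * ∫⁻ y, f₁ y ∂μ + C * ∫⁻ s in Ioi (0:ℝ) \ S, Φ s) := fun x =>
    calc ENNReal.ofReal |h x| ≤ ∫⁻ y, k (x - y) * ENNReal.ofReal |f y| ∂μ := hh x
      _ ≤ ∫⁻ y, (k₁ (x - y) * f₁ y + (κ * f₁ y + k (x - y) * f₂ y)) ∂μ := by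
          refine lintegral_mono fun y => ?_
          rw [hsplit y, mul_add, ← add_assoc, ← add_mul]
          gcongr
          exact hle _
      _ = g x + (κ * ∫⁻ y, f₁ y ∂μ + ∫⁻ y, k (x - y) * f₂ y ∂μ) := by
          have hm : Measurable fun y => k₁ (x - y) * f₁ y := (hk₁.comp (hsubx x)).mul hf₁m
          rw [lintegral_add_left hm,
            lintegral_add_left (hf₁m.const_mul κ), lintegral_const_mul _ hf₁m]
      _ ≤ _ := by gcongr; exact hf₂bd x
  have hsmall : (C * ENNReal.ofReal (t ^ a)) * ∫⁻ s in Ioi (0:ℝ) ∩ S, distrib μ f s ≤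
      ENNReal.ofReal t * (C * ∫⁻ s in Ioi (0:ℝ) ∩ S, Φ s) := by
    have hta : ENNReal.ofReal (t ^ a) = ENNReal.ofReal t * ENNReal.ofReal (t ^ (a - 1)) := by
      rw [← ENNReal.ofReal_mul ht.le, Real.rpow_sub_one ht.ne', mul_div_cancel₀ _ ht.ne']
    calc _ = ENNReal.ofReal t * (C * ∫⁻ s in Ioi (0:ℝ) ∩ S,
            distrib μ f s * ENNReal.ofReal (t ^ (a - 1))) := by
          rw [lintegral_mul_const _ hdm, hta]; ring
      _ ≤ _ := by
          refine mul_le_mul_right (mul_le_mul_right ?_ _) _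
          refine setLIntegral_mono' (measurableSet_Ioi.inter hSm) fun s hs => ?_
          have hne : distrib μ f s ≠ ⊤ := ne_top_of_le_ne_top ENNReal.ofReal_ne_top hs.2
          have hmax : max (distrib μ f s).toReal t = t :=
            max_eq_right (ENNReal.toReal_le_of_le_ofReal ht.le hs.2)
          have := mul_ofReal_rpow_le_lintegral ha ht hne
          rwa [hmax] at this
  calc ∫⁻ u in Ioc (0:ℝ) t, rearr μ h u
      ≤ ∫⁻ x, g x ∂μ + ENNReal.ofReal t *
          (κ * ∫⁻ y, f₁ y ∂μ + C * ∫⁻ s in Ioi (0:ℝ) \ S, Φ s) :=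
        _root_.lintegral_rearr_le hgm _ hbound t
    _ = (∫⁻ z, k₁ z ∂μ + ENNReal.ofReal t * κ) * (∫⁻ s in Ioi (0:ℝ) ∩ S, distrib μ f s) +
          ENNReal.ofReal t * (C * ∫⁻ s in Ioi (0:ℝ) \ S, Φ s) := by
        rw [hgint, hf₁int]; ring
    _ ≤ (C * ENNReal.ofReal (t ^ a)) * (∫⁻ s in Ioi (0:ℝ) ∩ S, distrib μ f s) +
          ENNReal.ofReal t * (C * ∫⁻ s in Ioi (0:ℝ) \ S, Φ s) := by gcongr
    _ ≤ ENNReal.ofReal t * (C * ∫⁻ s in Ioi (0:ℝ) ∩ S, Φ s) +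
          ENNReal.ofReal t * (C * ∫⁻ s in Ioi (0:ℝ) \ S, Φ s) := by gcongr
    _ = ENNReal.ofReal t * (C * ∫⁻ s in Ioi (0:ℝ), Φ s) := by
        rw [← mul_add, ← mul_add, lintegral_inter_add_sdiff _ _ hSm]
    _ = _ := by
        rw [hΦ, lintegral_lintegral_ltInd_distrib (by fun_prop)]

end Kernel

section Hardy

lemma lintegral_rpow_le_measure_univ_rpow_mul {X : Type*} [MeasurableSpace X] (μ : Measure X)
    {q : ℝ} (hq : 1 ≤ q) {F : X → ℝ≥0∞} (hF : Measurable F) :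
    (∫⁻ x, F x ∂μ) ^ q ≤ μ univ ^ (q - 1) * ∫⁻ x, F x ^ q ∂μ := by
  have hq0 : 0 < q := by linarith
  have h := eLpNorm'_le_eLpNorm'_mul_rpow_measure_univ (μ := μ) one_pos hq
    hF.aestronglyMeasurable
  simp only [eLpNorm'_eq_lintegral_enorm, enorm_eq_self, ENNReal.rpow_one, div_one] at h
  calc (∫⁻ x, F x ∂μ) ^ q
      ≤ ((∫⁻ x, F x ^ q ∂μ) ^ (1 / q) * μ univ ^ (1 - 1 / q)) ^ q := by gcongr
    _ = _ := by
        rw [ENNReal.mul_rpow_of_nonneg _ _ hq0.le, ← ENNReal.rpow_mul, ← ENNReal.rpow_mul,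
          mul_comm, one_div_mul_cancel hq0.ne', ENNReal.rpow_one]
        congr 2
        field_simp

lemma lintegral_Ioi_rpow {b t : ℝ} (hb : 0 < b) (ht : 0 < t) :
    ∫⁻ u in Ioi t, ENNReal.ofReal (t ^ b * u ^ (-b - 1)) = ENNReal.ofReal (1 / b) := by
  have hi := (integrableOn_Ioi_rpow_of_lt (show -b - 1 < -1 by linarith) ht).const_mul (t ^ b)
  rw [← ofReal_integral_eq_lintegral_ofReal hi, integral_const_mul,
    integral_Ioi_rpow_of_lt (by linarith) ht]
  · congr 1
    have h1 : t ^ b * t ^ (-b) = 1 := by rw [← Real.rpow_add ht]; simp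
    rw [show -b - 1 + 1 = -b by ring, neg_div_neg_eq, ← mul_div_assoc, h1]
  · filter_upwards [ae_restrict_mem measurableSet_Ioi] with u hu
    have : 0 < u := ht.trans hu
    simp only [Pi.zero_apply]
    positivity

lemma lintegral_Ioo_rpow {b u : ℝ} (hb : 0 < b) (hu : 0 < u) :
    ∫⁻ t in Ioo 0 u, ENNReal.ofReal (t ^ (b - 1)) = ENNReal.ofReal (u ^ b / b) := by
  have hi : IntegrableOn (fun t : ℝ => t ^ (b - 1)) (Ioc 0 u) :=
    (intervalIntegrable_iff_integrableOn_Ioc_of_le hu.le).1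
      (intervalIntegral.intervalIntegrable_rpow' (by linarith))
  rw [restrict_Ioo_eq_restrict_Ioc, ← ofReal_integral_eq_lintegral_ofReal hi,
    ← intervalIntegral.integral_of_le hu.le, integral_rpow (Or.inl (by linarith))]
  · congr 1
    simp [Real.zero_rpow hb.ne']
  · filter_upwards [ae_restrict_mem measurableSet_Ioc] with t ht
    have : 0 < t := ht.1
    simp only [Pi.zero_apply]
    positivity

lemma lintegral_Ioi_lintegral_Ioi_swap {K : ℝ → ℝ → ℝ≥0∞} (hK : Measurable (Function.uncurry K)) :
    ∫⁻ t in Ioi (0:ℝ), ∫⁻ u in Ioi t, K t u = ∫⁻ u in Ioi (0:ℝ), ∫⁻ t in Ioo 0 u, K t u := by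
  have hm : Measurable (Function.uncurry fun t u : ℝ =>
      {z : ℝ × ℝ | 0 < z.1 ∧ z.1 < z.2}.indicator (Function.uncurry K) (t, u)) :=
    hK.indicator ((measurableSet_lt measurable_const measurable_fst).inter
      (measurableSet_lt measurable_fst measurable_snd))
  calc _ = ∫⁻ t : ℝ, ∫⁻ u : ℝ,
        {z : ℝ × ℝ | 0 < z.1 ∧ z.1 < z.2}.indicator (Function.uncurry K) (t, u) := by
        rw [← lintegral_indicator measurableSet_Ioi]
        refine lintegral_congr fun t => ?_
        by_cases ht : 0 < t
        · rw [indicator_of_mem (show t ∈ Ioi 0 from ht), ← lintegral_indicator measurableSet_Ioi]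
          refine lintegral_congr fun u => ?_
          by_cases hu : t < u <;> simp [indicator, ht, hu]
        · simp [indicator, ht]
    _ = ∫⁻ u : ℝ, ∫⁻ t : ℝ,
        {z : ℝ × ℝ | 0 < z.1 ∧ z.1 < z.2}.indicator (Function.uncurry K) (t, u) :=
        lintegral_lintegral_swap hm.aemeasurable
    _ = _ := by
        rw [← lintegral_indicator measurableSet_Ioi]
        refine lintegral_congr fun u => ?_
        by_cases hu : 0 < u
        · rw [indicator_of_mem (show u ∈ Ioi 0 from hu), ← lintegral_indicator measurableSet_Ioo]
          refine lintegral_congr fun t => ?_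
          by_cases ht : 0 < t ∧ t < u <;> simp [indicator, ht]
        · rw [indicator_of_notMem (show u ∉ Ioi 0 from hu)]
          have : ∀ t : ℝ, ¬ (0 < t ∧ t < u) := fun t h => hu (h.1.trans h.2)
          simp [indicator, this]

lemma measurable_lintegral_Ioi {K : ℝ → ℝ → ℝ≥0∞} (hK : Measurable (Function.uncurry K)) :
    Measurable fun t => ∫⁻ u in Ioi t, K t u := by
  have hm : Measurable (Function.uncurry fun t u : ℝ =>
      {z : ℝ × ℝ | z.1 < z.2}.indicator (Function.uncurry K) (t, u)) :=
    hK.indicator (measurableSet_lt measurable_fst measurable_snd)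
  convert hm.lintegral_prod_right (ν := volume) using 2 with t
  rw [← lintegral_indicator measurableSet_Ioi]
  refine lintegral_congr fun u => ?_
  by_cases hu : t < u <;> simp [indicator, hu]

/-- Weighted Hardy inequality for the averaging operator over `(t, ∞)`. -/
lemma lintegral_hardy {b q : ℝ} (hb : 0 < b) (hq : 1 ≤ q) {F : ℝ → ℝ≥0∞} (hF : Measurable F) :
    (∫⁻ t in Ioi (0:ℝ), (∫⁻ u in Ioi t, ENNReal.ofReal (t ^ b * u ^ (-b - 1)) * F u) ^ q *
        (ENNReal.ofReal t)⁻¹) ^ (1 / q) ≤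
      ENNReal.ofReal (1 / b) *
        (∫⁻ t in Ioi (0:ℝ), F t ^ q * (ENNReal.ofReal t)⁻¹) ^ (1 / q) := by
  have hq0 : 0 < q := by linarith
  have hFq : Measurable fun u => F u ^ q := hF.pow_const q
  have hw : Measurable (Function.uncurry fun t u : ℝ =>
      ENNReal.ofReal (t ^ b * u ^ (-b - 1))) := by
    unfold Function.uncurry; fun_prop
  have hjensen : ∀ t : ℝ, 0 < t →
      (∫⁻ u in Ioi t, ENNReal.ofReal (t ^ b * u ^ (-b - 1)) * F u) ^ q ≤
        ENNReal.ofReal (1 / b) ^ (q - 1) *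
          ∫⁻ u in Ioi t, ENNReal.ofReal (t ^ b * u ^ (-b - 1)) * F u ^ q := fun t ht => by
    have hwt : Measurable fun u : ℝ => ENNReal.ofReal (t ^ b * u ^ (-b - 1)) := by fun_prop
    have h := lintegral_rpow_le_measure_univ_rpow_mul
      ((volume.restrict (Ioi t)).withDensity fun u => ENNReal.ofReal (t ^ b * u ^ (-b - 1)))
      hq hF
    rwa [lintegral_withDensity_eq_lintegral_mul _ hwt hF,
      lintegral_withDensity_eq_lintegral_mul _ hwt hFq, withDensity_apply _ MeasurableSet.univ,
      Measure.restrict_univ, lintegral_Ioi_rpow hb ht] at h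
  have hK : Measurable (Function.uncurry fun t u : ℝ =>
      ENNReal.ofReal (t ^ b * u ^ (-b - 1)) * F u ^ q * (ENNReal.ofReal t)⁻¹) :=
    (hw.mul (hFq.comp measurable_snd)).mul (by fun_prop)
  have hinner : ∀ u : ℝ, 0 < u →
      ∫⁻ t in Ioo 0 u, ENNReal.ofReal (t ^ b * u ^ (-b - 1)) * F u ^ q * (ENNReal.ofReal t)⁻¹ =
        ENNReal.ofReal (1 / b) * (F u ^ q * (ENNReal.ofReal u)⁻¹) := fun u hu => by
    calc _ = ∫⁻ t in Ioo 0 u, ENNReal.ofReal (t ^ (b - 1)) *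
            (ENNReal.ofReal (u ^ (-b - 1)) * F u ^ q) := by
          refine setLIntegral_congr_fun measurableSet_Ioo fun t ht => ?_
          have ht0 : 0 < t := ht.1
          rw [ENNReal.ofReal_mul (by positivity), Real.rpow_sub_one ht0.ne',
            ENNReal.ofReal_div_of_pos ht0, div_eq_mul_inv]
          ring
      _ = ENNReal.ofReal (u ^ b / b * u ^ (-b - 1)) * F u ^ q := by
          rw [lintegral_mul_const _ (by fun_prop), lintegral_Ioo_rpow hb hu, ← mul_assoc,
            ENNReal.ofReal_mul (by positivity)]
      _ = _ := by
          have : u ^ b / b * u ^ (-b - 1) = 1 / b / u := by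
            have h1 : u ^ b * u ^ (-b - 1) = u⁻¹ := by
              rw [← Real.rpow_add hu, show b + (-b - 1) = -1 by ring, Real.rpow_neg_one]
            rw [div_mul_eq_mul_div, h1]; field_simp
          rw [this, ENNReal.ofReal_div_of_pos hu, div_eq_mul_inv]
          ring
  have hmain : ∫⁻ t in Ioi (0:ℝ),
      (∫⁻ u in Ioi t, ENNReal.ofReal (t ^ b * u ^ (-b - 1)) * F u) ^ q * (ENNReal.ofReal t)⁻¹ ≤
        ENNReal.ofReal (1 / b) ^ q * ∫⁻ t in Ioi (0:ℝ), F t ^ q * (ENNReal.ofReal t)⁻¹ := by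
    calc _ ≤ ∫⁻ t in Ioi (0:ℝ), ENNReal.ofReal (1 / b) ^ (q - 1) *
            ∫⁻ u in Ioi t,
              ENNReal.ofReal (t ^ b * u ^ (-b - 1)) * F u ^ q * (ENNReal.ofReal t)⁻¹ := by
          refine setLIntegral_mono' measurableSet_Ioi fun t ht => ?_
          have hm : Measurable fun u : ℝ => ENNReal.ofReal (t ^ b * u ^ (-b - 1)) * F u ^ q :=
            Measurable.mul (by fun_prop) hFq
          rw [lintegral_mul_const _ hm, ← mul_assoc]
          gcongr
          exact hjensen t ht
      _ = ENNReal.ofReal (1 / b) ^ (q - 1) * ∫⁻ u in Ioi (0:ℝ), ∫⁻ t in Ioo 0 u,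
              ENNReal.ofReal (t ^ b * u ^ (-b - 1)) * F u ^ q * (ENNReal.ofReal t)⁻¹ := by
          rw [lintegral_const_mul _ (measurable_lintegral_Ioi hK),
            lintegral_Ioi_lintegral_Ioi_swap hK]
      _ = ENNReal.ofReal (1 / b) ^ (q - 1) * (ENNReal.ofReal (1 / b) *
              ∫⁻ u in Ioi (0:ℝ), F u ^ q * (ENNReal.ofReal u)⁻¹) := by
          have hm : Measurable fun u : ℝ => F u ^ q * (ENNReal.ofReal u)⁻¹ := by fun_prop
          rw [setLIntegral_congr_fun measurableSet_Ioi hinner, lintegral_const_mul _ hm]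
      _ = _ := by
          have hne : ENNReal.ofReal (1 / b) ≠ 0 := by simpa using hb
          rw [← mul_assoc, ENNReal.rpow_sub _ _ hne ENNReal.ofReal_ne_top, ENNReal.rpow_one,
            ENNReal.div_mul_cancel hne ENNReal.ofReal_ne_top]
  calc _ ≤ (ENNReal.ofReal (1 / b) ^ q *
        ∫⁻ t in Ioi (0:ℝ), F t ^ q * (ENNReal.ofReal t)⁻¹) ^ (1 / q) := by gcongr
    _ = _ := by
        rw [ENNReal.mul_rpow_of_nonneg _ _ (by positivity), ← ENNReal.rpow_mul,
          mul_one_div_cancel hq0.ne', ENNReal.rpow_one]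

end Hardy

section RieszKernel

lemma measurable_riesz_kernel (n : ℕ) (α : ℝ) :
    Measurable fun z : EuclideanSpace ℝ (Fin n) => ENNReal.ofReal (‖z‖ ^ (α - (n:ℝ))) := by
  fun_prop

lemma lintegral_ball_norm_rpow {n : ℕ} (hn : 1 ≤ n) {α R : ℝ} (hα : 0 < α) (hR : 0 < R) :
    ∫⁻ z in Metric.ball (0 : EuclideanSpace ℝ (Fin n)) R, ENNReal.ofReal (‖z‖ ^ (α - (n:ℝ))) =
      ENNReal.ofReal (n * (volume (Metric.ball (0 : EuclideanSpace ℝ (Fin n)) 1)).toReal *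
        (R ^ α / α)) := by
  have : Nonempty (Fin n) := ⟨⟨0, hn⟩⟩
  have hpow : ∀ y : ℝ, 0 < y → y ^ (n - 1) * y ^ (α - (n:ℝ)) = y ^ (α - 1) := fun y hy => by
    rw [← Real.rpow_natCast, ← Real.rpow_add hy, Nat.cast_sub hn]
    congr 1; push_cast; ring
  have hint1 : IntegrableOn (fun t : ℝ => t ^ (α - 1)) (Ioo 0 R) :=
    ((intervalIntegrable_iff_integrableOn_Ioc_of_le hR.le).1
      (intervalIntegral.intervalIntegrable_rpow' (by linarith))).mono_set Ioo_subset_Ioc_self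
  have hval : ∫ t in Ioo 0 R, t ^ (α - 1) = R ^ α / α := by
    rw [← integral_Ioc_eq_integral_Ioo, ← intervalIntegral.integral_of_le hR.le,
      integral_rpow (Or.inl (by linarith))]
    simp [Real.zero_rpow hα.ne']
  have hint : IntegrableOn (fun z : EuclideanSpace ℝ (Fin n) => ‖z‖ ^ (α - (n:ℝ)))
      (Metric.ball 0 R) := by
    rw [integrableOn_fun_norm_addHaar volume (f := fun y : ℝ => y ^ (α - (n:ℝ)))]
    refine hint1.congr_fun (fun y hy => ?_) measurableSet_Ioo
    simp [hpow y hy.1]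
  rw [← ofReal_integral_eq_lintegral_ofReal hint (ae_of_all _ fun z => by positivity)]
  congr 1
  have h := integral_fun_norm_addHaar (volume : Measure (EuclideanSpace ℝ (Fin n)))
    ((Iio R).indicator fun y : ℝ => y ^ (α - (n:ℝ)))
  have hleft : ∫ z : EuclideanSpace ℝ (Fin n),
      (Iio R).indicator (fun y : ℝ => y ^ (α - (n:ℝ))) ‖z‖ =
      ∫ z in Metric.ball (0 : EuclideanSpace ℝ (Fin n)) R, ‖z‖ ^ (α - (n:ℝ)) := by
    rw [← integral_indicator measurableSet_ball]
    congr 1; ext z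
    simp [indicator]
  have hright : ∫ y in Ioi (0:ℝ), y ^ (n - 1) •
      (Iio R).indicator (fun y : ℝ => y ^ (α - (n:ℝ))) y = R ^ α / α := by
    rw [← hval, ← integral_indicator measurableSet_Ioi, ← integral_indicator measurableSet_Ioo]
    congr 1; ext y
    by_cases h0 : 0 < y
    · by_cases h1 : y < R
      · simp [indicator, h0, h1, hpow y h0]
      · simp [indicator, h1]
    · simp [indicator, h0]
  rw [← hleft, h, finrank_euclideanSpace_fin, hright]
  simp [Measure.real, mul_assoc]

lemma weakKernel_riesz {n : ℕ} (hn : 1 ≤ n) {α : ℝ} (hα : 0 < α) (hαn : α < n) :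
    WeakKernel volume (fun z : EuclideanSpace ℝ (Fin n) => ENNReal.ofReal (‖z‖ ^ (α - (n:ℝ))))
      (ENNReal.ofReal ((n / α + 1) *
        ((volume (Metric.ball (0 : EuclideanSpace ℝ (Fin n)) 1)).toReal) ^ (((n:ℝ) - α) / n)))
      (α / n) := by
  intro t ht
  have : Nonempty (Fin n) := ⟨⟨0, hn⟩⟩
  have hn0 : (0:ℝ) < n := by exact_mod_cast hn
  set A := (volume (Metric.ball (0 : EuclideanSpace ℝ (Fin n)) 1)).toReal with hAdef
  have hA : 0 < A := ENNReal.toReal_pos (Metric.measure_ball_pos _ _ one_pos).ne'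
    measure_ball_lt_top.ne
  set R := (t / A) ^ (1 / (n:ℝ)) with hRdef
  have htA : 0 < t / A := div_pos ht hA
  have hR : 0 < R := Real.rpow_pos_of_pos htA _
  have hRα : R ^ α = (t / A) ^ (α / n) := by
    rw [hRdef, ← Real.rpow_mul htA.le]; congr 1; ring
  have hRαn : R ^ (α - n) = (t / A) ^ (α / n) * (A / t) := by
    rw [hRdef, ← Real.rpow_mul htA.le, show 1 / (n:ℝ) * (α - n) = α / n - 1 by field_simp,
      Real.rpow_sub_one htA.ne']
    field_simp
  have hAa : A * (t / A) ^ (α / n) = A ^ (((n:ℝ) - α) / n) * t ^ (α / n) := by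
    rw [Real.div_rpow ht.le hA.le, show ((n:ℝ) - α) / n = 1 - α / n by field_simp,
      Real.rpow_sub hA, Real.rpow_one]
    ring
  refine ⟨(Metric.ball 0 R).indicator fun z => ENNReal.ofReal (‖z‖ ^ (α - (n:ℝ))),
    (measurable_riesz_kernel n α).indicator measurableSet_ball,
    ENNReal.ofReal (R ^ (α - n)), fun z => ?_, ?_⟩
  · by_cases hz : z ∈ Metric.ball 0 R
    · simp [hz]
    · rw [indicator_of_notMem hz, zero_add]
      refine ENNReal.ofReal_le_ofReal (Real.rpow_le_rpow_of_nonpos hR ?_ (by linarith))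
      simpa using hz
  · rw [lintegral_indicator measurableSet_ball, lintegral_ball_norm_rpow hn hα hR,
      ← ENNReal.ofReal_mul ht.le, ← ENNReal.ofReal_add (by positivity) (by positivity),
      ← ENNReal.ofReal_mul (by positivity)]
    refine ENNReal.ofReal_le_ofReal (le_of_eq ?_)
    rw [mul_assoc (_ + 1), ← hAa, hRαn, hRα, ← hAdef]
    field_simp

end RieszKernel

section Lorentz

lemma enorm_riesz_le (n : ℕ) (α : ℝ) (f : EuclideanSpace ℝ (Fin n) → ℝ)
    (x : EuclideanSpace ℝ (Fin n)) :
    ENNReal.ofReal |riesz n α f x| ≤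
      ∫⁻ y, ENNReal.ofReal (‖x - y‖ ^ (α - (n:ℝ))) * ENNReal.ofReal |f y| := by
  rw [← Real.enorm_eq_ofReal_abs]
  refine (enorm_integral_le_lintegral_enorm _).trans (lintegral_mono fun y => ?_)
  rw [enorm_mul, Real.enorm_eq_ofReal_abs, Real.enorm_eq_ofReal_abs,
    abs_of_nonneg (Real.rpow_nonneg (norm_nonneg _) _)]

/-- Splitting the weighted integral of the rearrangement at `t`, in terms of the maximal
function. -/
lemma rpow_mul_lintegral_rearr_le {X : Type*} [MeasurableSpace X] (μ : Measure X) (f : X → ℝ)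
    {c b t : ℝ} (ht : 0 < t) :
    ENNReal.ofReal t ^ b *
        ∫⁻ u in Ioi (0:ℝ), rearr μ f u * ENNReal.ofReal ((max u t) ^ (c - b - 1)) ≤
      ENNReal.ofReal t ^ c * maxFn μ f t +
        ∫⁻ u in Ioi t, ENNReal.ofReal (t ^ b * u ^ (-b - 1)) *
          (ENNReal.ofReal u ^ c * maxFn μ f u) := by
  have hrm := measurable_rearr μ f
  have ht0 : ENNReal.ofReal t ≠ 0 := by simpa using ht
  rw [← Ioc_union_Ioi_eq_Ioi ht.le, lintegral_union measurableSet_Ioi (Ioc_disjoint_Ioi le_rfl),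
    mul_add]
  refine add_le_add (le_of_eq ?_) ?_
  · calc _ = ENNReal.ofReal t ^ b *
          ∫⁻ u in Ioc 0 t, rearr μ f u * ENNReal.ofReal (t ^ (c - b - 1)) := by
          congr 1
          refine setLIntegral_congr_fun measurableSet_Ioc fun u hu => ?_
          rw [max_eq_right hu.2]
      _ = (ENNReal.ofReal t ^ b * ENNReal.ofReal t ^ (c - b - 1)) *
            ∫⁻ u in Ioc 0 t, rearr μ f u := by
          rw [lintegral_mul_const _ hrm, ENNReal.ofReal_rpow_of_pos (p := c - b - 1) ht]; ring
      _ = _ := by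
          rw [← ENNReal.rpow_add _ _ ht0 ENNReal.ofReal_ne_top, maxFn,
            show b + (c - b - 1) = c + -1 by ring,
            ENNReal.rpow_add _ _ ht0 ENNReal.ofReal_ne_top, ENNReal.rpow_neg_one, mul_assoc]
  · have hm : Measurable fun u : ℝ => rearr μ f u * ENNReal.ofReal ((max u t) ^ (c - b - 1)) :=
      hrm.mul (by fun_prop)
    rw [← lintegral_const_mul _ hm]
    refine setLIntegral_mono' measurableSet_Ioi fun u hu => ?_
    have hu0 : 0 < u := ht.trans hu
    rw [max_eq_left (le_of_lt hu), ENNReal.ofReal_rpow_of_pos ht, ENNReal.ofReal_rpow_of_pos hu0,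
      ENNReal.ofReal_mul (by positivity),
      show c - b - 1 = -b - 1 + c by ring, Real.rpow_add hu0, ENNReal.ofReal_mul (by positivity)]
    calc _ = ENNReal.ofReal (t ^ b) * ENNReal.ofReal (u ^ (-b - 1)) *
          (ENNReal.ofReal (u ^ c) * rearr μ f u) := by ring
      _ ≤ _ := by gcongr; exact rearr_le_maxFn μ f hu0

/-- A pointwise bound of maximal functions by a Hardy operator gives a Lorentz norm bound. -/
lemma lorentzNorm_le_of_hardy {X Y : Type*} [MeasurableSpace X] [MeasurableSpace Y]
    {μ : Measure X} {ν : Measure Y} {f : X → ℝ} {h : Y → ℝ} {p r : ℝ} (hr : 0 < r)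
    {q : ℝ≥0∞} (hq : 1 ≤ q) {C : ℝ≥0∞}
    (hbound : ∀ t : ℝ, 0 < t → ENNReal.ofReal t ^ (1 / r) * maxFn ν h t ≤
      C * (ENNReal.ofReal t ^ (1 / p) * maxFn μ f t +
        ∫⁻ u in Ioi t, ENNReal.ofReal (t ^ (1 / r) * u ^ (-(1 / r) - 1)) *
          (ENNReal.ofReal u ^ (1 / p) * maxFn μ f u))) :
    lorentzNorm ν h r q ≤ C * ENNReal.ofReal (1 + r) * lorentzNorm μ f p q := by
  have hb : 0 < 1 / r := by positivity
  have hsum : ENNReal.ofReal (1 + r) = 1 + ENNReal.ofReal r := by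
    rw [ENNReal.ofReal_add one_pos.le hr.le, ENNReal.ofReal_one]
  have hmf := measurable_maxFn μ f
  set F : ℝ → ℝ≥0∞ := fun u => ENNReal.ofReal u ^ (1 / p) * maxFn μ f u with hF
  have hFm : Measurable F := by fun_prop
  unfold lorentzNorm
  split_ifs with hqt
  · refine iSup₂_le fun t ht => (hbound t ht).trans ?_
    rw [mul_assoc, hsum, add_mul, one_mul]
    set N := ⨆ (t : ℝ) (_ : 0 < t), ENNReal.ofReal t ^ (1 / p) * maxFn μ f t
    have hN : ∀ u : ℝ, 0 < u → F u ≤ N := fun u hu =>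
      le_iSup₂_of_le (f := fun (t : ℝ) (_ : 0 < t) =>
        ENNReal.ofReal t ^ (1 / p) * maxFn μ f t) u hu le_rfl
    gcongr
    · exact hN t ht
    · calc _ ≤ ∫⁻ u in Ioi t, ENNReal.ofReal (t ^ (1 / r) * u ^ (-(1 / r) - 1)) * N := by
            refine setLIntegral_mono' measurableSet_Ioi fun u hu => ?_
            gcongr
            exact hN u (ht.trans hu)
        _ = _ := by
            rw [lintegral_mul_const _ (by fun_prop), lintegral_Ioi_rpow hb ht, one_div_one_div]
  · have hq1 : 1 ≤ q.toReal := by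
      rw [← ENNReal.toReal_one]
      exact ENNReal.toReal_mono hqt hq
    generalize q.toReal = q at hq1
    have hq0 : 0 < q := by linarith
    set W : ℝ → ℝ≥0∞ := fun t => (ENNReal.ofReal t)⁻¹ with hW
    have hWm : Measurable W := by fun_prop
    set G : ℝ → ℝ≥0∞ := fun t =>
      ∫⁻ u in Ioi t, ENNReal.ofReal (t ^ (1 / r) * u ^ (-(1 / r) - 1)) * F u with hG
    have hGm : Measurable G := measurable_lintegral_Ioi (Measurable.mul
      (by fun_prop) (hFm.comp measurable_snd))
    set m := (volume.restrict (Ioi (0:ℝ))).withDensity W with hm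
    have hlin : ∀ H : ℝ → ℝ≥0∞, Measurable H →
        ∫⁻ t in Ioi (0:ℝ), H t ^ q * (ENNReal.ofReal t)⁻¹ = ∫⁻ t, H t ^ q ∂m := fun H hH => by
      rw [hm, lintegral_withDensity_eq_lintegral_mul _ hWm (hH.pow_const q)]
      simp only [Pi.mul_apply, mul_comm, hW]
    calc _ ≤ (∫⁻ t in Ioi (0:ℝ), (C * (F t + G t)) ^ q * (ENNReal.ofReal t)⁻¹) ^ (1 / q) := by
          refine ENNReal.rpow_le_rpow ?_ (by positivity)
          refine setLIntegral_mono' measurableSet_Ioi fun t ht => ?_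
          exact mul_le_mul' (ENNReal.rpow_le_rpow (hbound t ht) hq0.le) le_rfl
      _ = C * (∫⁻ t, (F + G) t ^ q ∂m) ^ (1 / q) := by
          have hFG : Measurable fun t => (F t + G t) ^ q := by fun_prop
          rw [hlin (fun t => C * (F t + G t)) (by fun_prop)]
          simp only [ENNReal.mul_rpow_of_nonneg _ _ hq0.le, Pi.add_apply]
          rw [lintegral_const_mul _ hFG, ENNReal.mul_rpow_of_nonneg _ _ (by positivity),
            ← ENNReal.rpow_mul, mul_one_div_cancel hq0.ne', ENNReal.rpow_one]
      _ ≤ C * ((∫⁻ t, F t ^ q ∂m) ^ (1 / q) + (∫⁻ t, G t ^ q ∂m) ^ (1 / q)) := by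
          gcongr
          exact ENNReal.lintegral_Lp_add_le hFm.aemeasurable hGm.aemeasurable hq1
      _ ≤ C * ((∫⁻ t, F t ^ q ∂m) ^ (1 / q) +
            ENNReal.ofReal r * (∫⁻ t, F t ^ q ∂m) ^ (1 / q)) := by
          gcongr
          have := lintegral_hardy hb hq1 hFm
          rwa [hlin G hGm, hlin F hFm, one_div_one_div] at this
      _ = _ := by
          rw [hlin F hFm, hsum]; ring

end Lorentz

/-- **Boundedness of the Riesz potential on Lorentz spaces**: for `1 ≤ p < ∞`,
`1 ≤ q ≤ ∞`, `0 < α < n/p`, `1/r = 1/p - α/n`, and `A` the volume of the unit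
ball of ℝⁿ, if `f ∈ L^{p,q}(ℝⁿ)` then `I_α f ∈ L^{r,q}(ℝⁿ)` and
`‖I_α f‖_{r,q} ≤ (3 r n / α) A^{(n-α)/n} ‖f‖_{p,q}`. -/
theorem riesz_potential_lorentz_bound (n : ℕ) (hn : 1 ≤ n)
    (p r α : ℝ) (q : ℝ≥0∞)
    (hp : 1 ≤ p) (hq : 1 ≤ q)
    (hα : 0 < α) (hαp : α < (n:ℝ) / p)
    (hr : 1 / r = 1 / p - α / (n:ℝ))
    (f : EuclideanSpace ℝ (Fin n) → ℝ) (hf : Measurable f)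
    (hfL : lorentzNorm volume f p q < ⊤) :
    lorentzNorm volume (riesz n α f) r q < ⊤ ∧
      lorentzNorm volume (riesz n α f) r q ≤
        ENNReal.ofReal (3 * r * (n:ℝ) / α *
            ((volume (Metric.ball (0 : EuclideanSpace ℝ (Fin n)) 1)).toReal)
              ^ (((n:ℝ) - α) / (n:ℝ))) *
          lorentzNorm volume f p q := by
  have hn0 : (0:ℝ) < n := by exact_mod_cast hn
  have hp0 : 0 < p := by linarith
  have hαn : α < n := hαp.trans_le (div_le_self hn0.le hp)
  have hαpn : α * p < n := (lt_div_iff₀ hp0).1 hαp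
  have hrinv : 0 < 1 / r := by
    rw [hr, sub_pos, div_lt_div_iff₀ hn0 hp0]; linarith
  have hr0 : 0 < r := one_div_pos.1 hrinv
  set A := (volume (Metric.ball (0 : EuclideanSpace ℝ (Fin n)) 1)).toReal with hA
  have : Nonempty (Fin n) := ⟨⟨0, hn⟩⟩
  have hA0 : 0 < A := ENNReal.toReal_pos (Metric.measure_ball_pos _ _ one_pos).ne'
    measure_ball_lt_top.ne
  set B := A ^ (((n:ℝ) - α) / n) with hB
  have hB0 : 0 < B := Real.rpow_pos_of_pos hA0 _
  have hC0 : 0 < (n / α + 1) * B := by positivity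
  have hpt : ∀ t : ℝ, 0 < t → ENNReal.ofReal t ^ (1 / r) * maxFn volume (riesz n α f) t ≤
      ENNReal.ofReal ((n / α + 1) * B) * (ENNReal.ofReal t ^ (1 / p) * maxFn volume f t +
        ∫⁻ u in Ioi t, ENNReal.ofReal (t ^ (1 / r) * u ^ (-(1 / r) - 1)) *
          (ENNReal.ofReal u ^ (1 / p) * maxFn volume f u)) := fun t ht => by
    have ht0 : ENNReal.ofReal t ≠ 0 := by simpa using ht
    have h1 := (weakKernel_riesz hn hα hαn).lintegral_rearr_le (measurable_riesz_kernel n α)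
      (div_pos hα hn0) ((div_lt_one hn0).2 hαn) (by simpa using hC0) hf
      (enorm_riesz_le n α f) ht
    have h2 := rpow_mul_lintegral_rearr_le volume f (c := 1 / p) (b := 1 / r) ht
    rw [show 1 / p - 1 / r - 1 = α / n - 1 by rw [hr]; ring] at h2
    calc _ ≤ ENNReal.ofReal t ^ (1 / r) * ((ENNReal.ofReal t)⁻¹ * (ENNReal.ofReal t *
          (ENNReal.ofReal ((n / α + 1) * B) * ∫⁻ u in Ioi (0:ℝ),
            rearr volume f u * ENNReal.ofReal ((max u t) ^ (α / n - 1))))) := by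
          unfold maxFn
          gcongr
      _ = ENNReal.ofReal ((n / α + 1) * B) * (ENNReal.ofReal t ^ (1 / r) *
          ∫⁻ u in Ioi (0:ℝ), rearr volume f u * ENNReal.ofReal ((max u t) ^ (α / n - 1))) := by
          rw [← mul_assoc (ENNReal.ofReal t)⁻¹, ENNReal.inv_mul_cancel ht0 ENNReal.ofReal_ne_top]
          ring
      _ ≤ _ := by gcongr
  have hconst : (n / α + 1) * B * (1 + r) ≤ 3 * r * n / α * B := by
    have hx : 0 < n / α := by positivity
    have hx1 : 1 < n / α := (one_lt_div hα).2 hαn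
    have h1 : 1 / r ≤ 1 - 1 / (n / α) := by
      rw [hr, one_div_div]
      have : 1 / p ≤ 1 := (div_le_one hp0).2 hp
      linarith
    have h2 : n / α + r ≤ r * (n / α) := by
      have := mul_le_mul_of_nonneg_left h1 (mul_pos hr0 hx).le
      have e1 : r * (n / α) * (1 / r) = n / α := by field_simp
      have e2 : r * (n / α) * (1 - 1 / (n / α)) = r * (n / α) - r := by
        generalize (n:ℝ) / α = x at hx
        field_simp
      linarith
    have h3 : (n / α + 1) * (1 + r) ≤ 3 * r * n / α := by
      rw [mul_div_assoc]
      nlinarith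
    calc _ = (n / α + 1) * (1 + r) * B := by ring
      _ ≤ _ := by gcongr
  have hle : lorentzNorm volume (riesz n α f) r q ≤
      ENNReal.ofReal (3 * r * n / α * B) * lorentzNorm volume f p q := by
    refine (lorentzNorm_le_of_hardy hr0 hq hpt).trans ?_
    rw [← ENNReal.ofReal_mul hC0.le]
    gcongr
  exact ⟨hle.trans_lt (ENNReal.mul_lt_top ENNReal.ofReal_lt_top hfL), hle⟩
end

section
/- Hardy–Littlewood–Sobolev theorem with explicit constant: let n ≥ 1, 1 < p < ∞, 0 < α < n/p, and define 1/r = 1/p − α/n. Let A denote the Lebesgue measure of the unit ball in ℝⁿ. If f ∈ L^p(ℝⁿ), then the Riesz potential I_α f(x) = ∫_{ℝⁿ} |x−y|^{α−n} f(y) dy belongs to L^r(ℝⁿ) and ‖I_α f‖_r ≤ C ‖f‖_p, where C = (3 p r/(p−1)) (p/r)^{1/p − 1/r} (n/α) A^{(n−α)/n}. -/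
open MeasureTheory Set
open scoped ENNReal

theorem lintegral_ofReal_mul_eq_lintegral_setLIntegral {X : Type*} [MeasurableSpace X]
    {μ : Measure X} {f : X → ℝ} {G : X → ℝ≥0∞} (hf : Measurable f) (hf0 : ∀ x, 0 ≤ f x)
    (hG : Measurable G) :
    ∫⁻ x, G x * ENNReal.ofReal (f x) ∂μ = ∫⁻ a in Ioi (0 : ℝ), ∫⁻ x in {x | a < f x}, G x ∂μ := by
  have h := lintegral_eq_lintegral_meas_lt (μ.withDensity G) (f := f)
    (Filter.Eventually.of_forall hf0) hf.aemeasurable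
  rw [lintegral_withDensity_eq_lintegral_mul _ hG hf.ennreal_ofReal] at h
  simp only [Pi.mul_apply] at h
  rw [h]
  refine lintegral_congr fun a => ?_
  rw [withDensity_apply _ (measurableSet_lt measurable_const hf)]

theorem lintegral_lintegral_kernel_layercake {X : Type*} [MeasurableSpace X]
    {μ : Measure X} [SFinite μ] {f h : X → ℝ} {k : X → X → ℝ≥0∞}
    (hf : Measurable f) (hf0 : ∀ x, 0 ≤ f x) (hh : Measurable h) (hh0 : ∀ x, 0 ≤ h x)
    (hk : Measurable (Function.uncurry k)) :
    ∫⁻ x, (∫⁻ y, k x y * ENNReal.ofReal (h y) ∂μ) * ENNReal.ofReal (f x) ∂μ =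
      ∫⁻ a in Ioi (0 : ℝ), ∫⁻ b in Ioi (0 : ℝ),
        ∫⁻ y in {y | b < h y}, ∫⁻ x in {x | a < f x}, k x y ∂μ ∂μ := by
  have hk' : Measurable (Function.uncurry fun x y => k x y * ENNReal.ofReal (h y)) :=
    hk.mul (hh.comp measurable_snd).ennreal_ofReal
  rw [lintegral_ofReal_mul_eq_lintegral_setLIntegral hf hf0 hk'.lintegral_prod_right]
  refine lintegral_congr fun a => ?_
  rw [lintegral_lintegral_swap hk'.aemeasurable,
    ← lintegral_ofReal_mul_eq_lintegral_setLIntegral hh hh0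
      (Measurable.lintegral_prod_right (f := fun y x => k x y) (hk.comp measurable_swap))]
  refine lintegral_congr fun y => ?_
  exact lintegral_mul_const _ (hk.comp (measurable_id.prodMk measurable_const))

theorem setLIntegral_Ioc_rpow {s T : ℝ} (hs : -1 < s) (hT : 0 ≤ T) :
    ∫⁻ b in Ioc 0 T, ENNReal.ofReal (b ^ s) = ENNReal.ofReal (T ^ (s + 1) / (s + 1)) := by
  have hi := intervalIntegral.intervalIntegrable_rpow' (a := 0) (b := T) hs
  rw [intervalIntegrable_iff_integrableOn_Ioc_of_le hT] at hi
  rw [← ofReal_integral_eq_lintegral_ofReal hi, ← intervalIntegral.integral_of_le hT,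
    integral_rpow (Or.inl hs), Real.zero_rpow (by linarith), sub_zero]
  filter_upwards [ae_restrict_mem measurableSet_Ioc] with b hb
  exact Real.rpow_nonneg hb.1.le _

theorem setLIntegral_Ioi_rpow {s c : ℝ} (hs : s < -1) (hc : 0 < c) :
    ∫⁻ b in Ioi c, ENNReal.ofReal (b ^ s) = ENNReal.ofReal (-c ^ (s + 1) / (s + 1)) := by
  rw [← ofReal_integral_eq_lintegral_ofReal (integrableOn_Ioi_rpow_of_lt hs hc),
    integral_Ioi_rpow_of_lt hs hc]
  filter_upwards [ae_restrict_mem measurableSet_Ioi] with b hb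
  exact Real.rpow_nonneg (hc.trans hb).le _

/-- Hölder's inequality against a power weight. -/
theorem setLIntegral_Ioc_rpow_le {V : ℝ → ℝ≥0∞} (hV : Measurable V) {q δ T : ℝ}
    (hδ : 0 < δ) (hδ1 : δ < 1) (hqδ : q * δ < 1) (hT : 0 ≤ T)
    (hV1 : ∫⁻ b in Ioi (0 : ℝ), V b * ENNReal.ofReal (b ^ (q - 1)) ≤ 1) :
    ∫⁻ b in Ioc 0 T, V b ^ δ ≤
      ENNReal.ofReal (((1 - δ) / (1 - q * δ)) ^ (1 - δ) * T ^ (1 - q * δ)) := by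
  set s : ℝ := -((q - 1) * δ / (1 - δ)) with hs
  have hδ' : 0 < 1 - δ := by linarith
  have hs1 : s + 1 = (1 - q * δ) / (1 - δ) := by rw [hs]; field_simp; ring
  have hs0 : 0 < s + 1 := by rw [hs1]; exact div_pos (by linarith) hδ'
  calc ∫⁻ b in Ioc 0 T, V b ^ δ
      = ∫⁻ b in Ioc 0 T, (V b * ENNReal.ofReal (b ^ (q - 1))) ^ δ *
          ENNReal.ofReal (b ^ s) ^ (1 - δ) := by
        refine setLIntegral_congr_fun measurableSet_Ioc fun b hb => ?_
        have hb0 : 0 < b := hb.1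
        have h1 : (0 : ℝ) < b ^ (q - 1) := Real.rpow_pos_of_pos hb0 _
        have h2 : (0 : ℝ) < b ^ s := Real.rpow_pos_of_pos hb0 _
        rw [ENNReal.mul_rpow_of_nonneg _ _ hδ.le, mul_assoc, ENNReal.ofReal_rpow_of_pos h1,
          ENNReal.ofReal_rpow_of_pos h2, ← ENNReal.ofReal_mul (by positivity),
          ← Real.rpow_mul hb0.le, ← Real.rpow_mul hb0.le, ← Real.rpow_add hb0]
        have : (q - 1) * δ + s * (1 - δ) = 0 := by rw [hs]; field_simp; ring
        rw [this]; simp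
    _ ≤ (∫⁻ b in Ioc 0 T, V b * ENNReal.ofReal (b ^ (q - 1))) ^ δ *
          (∫⁻ b in Ioc 0 T, ENNReal.ofReal (b ^ s)) ^ (1 - δ) :=
        ENNReal.lintegral_mul_norm_pow_le (by fun_prop) (by fun_prop) hδ.le hδ'.le (by ring)
    _ ≤ 1 * (∫⁻ b in Ioc 0 T, ENNReal.ofReal (b ^ s)) ^ (1 - δ) := by
        gcongr
        refine ENNReal.rpow_le_one ?_ hδ.le
        exact (lintegral_mono_set Ioc_subset_Ioi_self).trans hV1
    _ = _ := by
        rw [one_mul, setLIntegral_Ioc_rpow (by linarith) hT,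
          ENNReal.ofReal_rpow_of_nonneg (by positivity) hδ'.le, div_eq_mul_inv, mul_comm,
          Real.mul_rpow (by positivity) (by positivity), ← Real.rpow_mul hT, hs1, inv_div,
          div_mul_cancel₀ _ hδ'.ne']

/-- One half of the double level integral in the bilinear estimate. -/
theorem lintegral_level_half_le {U V : ℝ → ℝ≥0∞} (hU : Measurable U) (hV : Measurable V)
    {p q δ : ℝ} (hp : 1 < p) (hq : 1 < q) (hδ : 0 < δ) (hpq : 1 / p + 1 / q = 1 + δ)
    (hU1 : ∫⁻ a in Ioi (0 : ℝ), U a * ENNReal.ofReal (a ^ (p - 1)) ≤ 1)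
    (hV1 : ∫⁻ b in Ioi (0 : ℝ), V b * ENNReal.ofReal (b ^ (q - 1)) ≤ 1) :
    ∫⁻ a in Ioi (0 : ℝ), ∫⁻ b in Ioi (0 : ℝ),
        (if b ^ q ≤ a ^ p then U a * V b ^ δ else 0) ≤
      ENNReal.ofReal (((1 - δ) / (1 - q * δ)) ^ (1 - δ)) := by
  have hp0 : 0 < p := by linarith
  have hq0 : 0 < q := by linarith
  have hp1 : 1 / p < 1 := by rw [div_lt_one hp0]; exact hp
  have hq1 : 1 / q < 1 := by rw [div_lt_one hq0]; exact hq
  have hqδ : 1 - q * δ = q * (1 - 1 / p) := by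
    have : δ = 1 / p + 1 / q - 1 := by linarith
    rw [this]; field_simp; ring
  have hqδ' : q * δ < 1 := by nlinarith
  have hexp : p / q * (1 - q * δ) = p - 1 := by rw [hqδ]; field_simp
  calc _ ≤ ∫⁻ a in Ioi (0 : ℝ), ENNReal.ofReal (((1 - δ) / (1 - q * δ)) ^ (1 - δ)) *
          (U a * ENNReal.ofReal (a ^ (p - 1))) := by
        refine setLIntegral_mono (by fun_prop) fun a ha => ?_
        have ha0 : 0 < a := ha
        have hset : ∀ b ∈ Ioi (0 : ℝ), (if b ^ q ≤ a ^ p then U a * V b ^ δ else 0) =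
            U a * (Ioc 0 (a ^ (p / q))).indicator (fun b => V b ^ δ) b := by
          intro b hb
          have hb0 : 0 < b := hb
          have : b ^ q ≤ a ^ p ↔ b ≤ a ^ (p / q) := by
            rw [div_eq_mul_inv, Real.rpow_mul ha0.le,
              Real.le_rpow_inv_iff_of_pos hb0.le (by positivity) hq0]
          by_cases hba : b ^ q ≤ a ^ p
          · rw [if_pos hba, indicator_of_mem (show b ∈ Ioc 0 _ from ⟨hb0, this.1 hba⟩)]
          · rw [if_neg hba, indicator_of_notMem fun h => hba (this.2 h.2), mul_zero]
        rw [setLIntegral_congr_fun measurableSet_Ioi hset,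
          lintegral_const_mul _ ((hV.pow_const δ).indicator measurableSet_Ioc),
          lintegral_indicator measurableSet_Ioc, Measure.restrict_restrict measurableSet_Ioc,
          inter_eq_left.2 Ioc_subset_Ioi_self]
        refine (mul_le_mul_right (setLIntegral_Ioc_rpow_le hV hδ (by linarith) hqδ'
          (by positivity) hV1) _).trans_eq ?_
        have hD : 0 ≤ (1 - δ) / (1 - q * δ) := div_nonneg (by linarith) (by linarith)
        rw [← Real.rpow_mul ha0.le, hexp, ENNReal.ofReal_mul (by positivity)]
        ring
    _ ≤ _ := by
        rw [lintegral_const_mul _ (by fun_prop)]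
        exact mul_le_of_le_one_right' hU1

theorem lintegral_meas_lt_mul_rpow_le_one {X : Type*} [MeasurableSpace X]
    {μ : Measure X} {f : X → ℝ} (hf : Measurable f) (hf0 : ∀ x, 0 ≤ f x) {p : ℝ} (hp : 1 < p)
    (h : ∫⁻ x, ENNReal.ofReal (f x ^ p) ∂μ ≤ 1) :
    ∫⁻ a in Ioi (0 : ℝ), μ {x | a < f x} * ENNReal.ofReal (a ^ (p - 1)) ≤ 1 := by
  rw [lintegral_rpow_eq_lintegral_meas_lt_mul μ (Filter.Eventually.of_forall hf0)
    hf.aemeasurable (by linarith)] at h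
  refine le_trans (le_mul_of_one_le_left' ?_) h
  rw [← ENNReal.ofReal_one]
  exact ENNReal.ofReal_le_ofReal hp.le

/-- The bilinear Hardy–Littlewood–Sobolev inequality for an abstract kernel, normalised. -/
theorem lintegral_lintegral_kernel_le {X : Type*} [MeasurableSpace X]
    {μ : Measure X} [SFinite μ] {f h : X → ℝ} {k : X → X → ℝ≥0∞}
    (hf : Measurable f) (hf0 : ∀ x, 0 ≤ f x) (hh : Measurable h) (hh0 : ∀ x, 0 ≤ h x)
    (hk : Measurable (Function.uncurry k)) {p q δ : ℝ} {K : ℝ≥0∞}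
    (hp : 1 < p) (hq : 1 < q) (hδ : 0 < δ) (hpq : 1 / p + 1 / q = 1 + δ)
    (hk₁ : ∀ x (H : Set X), MeasurableSet H → ∫⁻ y in H, k x y ∂μ ≤ K * μ H ^ δ)
    (hk₂ : ∀ y (E : Set X), MeasurableSet E → ∫⁻ x in E, k x y ∂μ ≤ K * μ E ^ δ)
    (hf1 : ∫⁻ x, ENNReal.ofReal (f x ^ p) ∂μ ≤ 1)
    (hh1 : ∫⁻ x, ENNReal.ofReal (h x ^ q) ∂μ ≤ 1) :
    ∫⁻ x, (∫⁻ y, k x y * ENNReal.ofReal (h y) ∂μ) * ENNReal.ofReal (f x) ∂μ ≤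
      K * (ENNReal.ofReal (((1 - δ) / (1 - q * δ)) ^ (1 - δ)) +
        ENNReal.ofReal (((1 - δ) / (1 - p * δ)) ^ (1 - δ))) := by
  have hU1 := lintegral_meas_lt_mul_rpow_le_one hf hf0 hp hf1
  have hV1 := lintegral_meas_lt_mul_rpow_le_one hh hh0 hq hh1
  have hUV (g : X → ℝ) : Measurable fun a => μ {x | a < g x} :=
    Antitone.measurable fun a b hab => measure_mono fun x hx => lt_of_le_of_lt hab hx
  rw [lintegral_lintegral_kernel_layercake hf hf0 hh hh0 hk]
  set U : ℝ → ℝ≥0∞ := fun a => μ {x | a < f x} with hU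
  set V : ℝ → ℝ≥0∞ := fun a => μ {x | a < h x} with hV
  have hUm : Measurable U := hUV f
  have hVm : Measurable V := hUV h
  set A : ℝ → ℝ → ℝ≥0∞ := fun a b => if b ^ q ≤ a ^ p then U a * V b ^ δ else 0 with hA
  set B : ℝ → ℝ → ℝ≥0∞ := fun b a => if a ^ p ≤ b ^ q then V b * U a ^ δ else 0 with hB
  have hAm : Measurable (Function.uncurry A) :=
    Measurable.ite (measurableSet_le (by fun_prop) (by fun_prop)) (by fun_prop) measurable_const
  have hBm : Measurable (Function.uncurry B) :=
    Measurable.ite (measurableSet_le (by fun_prop) (by fun_prop)) (by fun_prop) measurable_const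
  have hBm' : Measurable (Function.uncurry fun a b => B b a) := hBm.comp measurable_swap
  have hEm (a : ℝ) : MeasurableSet {x | a < f x} := measurableSet_lt measurable_const hf
  have hHm (b : ℝ) : MeasurableSet {x | b < h x} := measurableSet_lt measurable_const hh
  have hle (a b : ℝ) : ∫⁻ y in {y | b < h y}, ∫⁻ x in {x | a < f x}, k x y ∂μ ∂μ ≤
      K * (A a b + B b a) := by
    rcases le_total (b ^ q) (a ^ p) with hab | hab
    · calc _ = ∫⁻ x in {x | a < f x}, ∫⁻ y in {y | b < h y}, k x y ∂μ ∂μ :=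
            (lintegral_lintegral_swap hk.aemeasurable).symm
        _ ≤ ∫⁻ x in {x | a < f x}, K * V b ^ δ ∂μ :=
            lintegral_mono fun x => hk₁ x _ (hHm b)
        _ = K * A a b := by
            rw [setLIntegral_const, hA]; simp only [if_pos hab, hU]; ring
        _ ≤ _ := by gcongr; exact le_self_add
    · calc _ ≤ ∫⁻ y in {y | b < h y}, K * U a ^ δ ∂μ :=
            lintegral_mono fun y => hk₂ y _ (hEm a)
        _ = K * B b a := by
            rw [setLIntegral_const, hB]; simp only [if_pos hab, hV]; ring
        _ ≤ _ := by gcongr; exact le_add_self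
  calc _ ≤ ∫⁻ a in Ioi (0 : ℝ), ∫⁻ b in Ioi (0 : ℝ), K * (A a b + B b a) :=
        lintegral_mono fun a => lintegral_mono fun b => hle a b
    _ = K * ((∫⁻ a in Ioi (0 : ℝ), ∫⁻ b in Ioi (0 : ℝ), A a b) +
          ∫⁻ a in Ioi (0 : ℝ), ∫⁻ b in Ioi (0 : ℝ), B b a) := by
        have hA1 : Measurable fun a => ∫⁻ b in Ioi (0 : ℝ), A a b := hAm.lintegral_prod_right
        have hB1 : Measurable fun a => ∫⁻ b in Ioi (0 : ℝ), B b a := hBm'.lintegral_prod_right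
        rw [← lintegral_add_left hA1, ← lintegral_const_mul _ (by fun_prop)]
        refine lintegral_congr fun a => ?_
        have h1 : Measurable (A a) := hAm.comp measurable_prodMk_left
        have h2 : Measurable fun b => B b a := hBm.comp measurable_prodMk_right
        rw [lintegral_const_mul K (f := fun b => A a b + B b a) (h1.add h2),
          lintegral_add_left h1]
    _ ≤ _ := by
        gcongr
        · exact lintegral_level_half_le hUm hVm hp hq hδ hpq hU1 hV1
        · rw [lintegral_lintegral_swap hBm'.aemeasurable]
          exact lintegral_level_half_le hVm hUm hq hp hδ (by linarith) hV1 hU1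

theorem setLIntegral_le_of_weak_type {X : Type*} [MeasurableSpace X]
    {μ : Measure X} {g : X → ℝ} (hg : Measurable g) (hg0 : ∀ x, 0 ≤ g x) {A θ : ℝ}
    (hA : 0 < A) (hθ : 0 < θ) (hθ1 : θ < 1)
    (hw : ∀ c, 0 < c → μ {x | c < g x} ≤ ENNReal.ofReal (A * c ^ (-1 / θ))) (H : Set X) :
    ∫⁻ x in H, ENNReal.ofReal (g x) ∂μ ≤ ENNReal.ofReal (A ^ θ / (1 - θ)) * μ H ^ (1 - θ) := by
  have hθ' : 0 < 1 - θ := by linarith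
  have hK : 0 < A ^ θ / (1 - θ) := by positivity
  rcases eq_or_ne (μ H) 0 with h0 | h0
  · rw [Measure.restrict_eq_zero.2 h0]; simp
  rcases eq_or_ne (μ H) ⊤ with ht | ht
  · rw [ht, ENNReal.top_rpow_of_pos hθ', ENNReal.mul_top (ENNReal.ofReal_pos.2 hK).ne']
    exact le_top
  set v := (μ H).toReal with hv
  have hv0 : 0 < v := ENNReal.toReal_pos h0 ht
  have hvH : μ H = ENNReal.ofReal v := (ENNReal.ofReal_toReal ht).symm
  set c := (A / v) ^ θ with hc
  have hc0 : 0 < c := by positivity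
  have hs : -1 / θ < -1 := by rw [div_lt_iff₀ hθ]; linarith
  have h1 : v * c = A ^ θ * v ^ (1 - θ) := by
    rw [hc, Real.div_rpow hA.le hv0.le, Real.rpow_sub hv0, Real.rpow_one]; ring
  have h2 : A * c ^ (-1 / θ + 1) = A ^ θ * v ^ (1 - θ) := by
    have : θ * (-1 / θ + 1) = θ - 1 := by field_simp; ring
    rw [hc, ← Real.rpow_mul (by positivity), this, Real.div_rpow hA.le hv0.le,
      Real.rpow_sub hA, Real.rpow_one, show 1 - θ = -(θ - 1) by ring, Real.rpow_neg hv0.le]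
    field_simp
  have h3 : 0 < A ^ θ * v ^ (1 - θ) := by positivity
  rw [lintegral_eq_lintegral_meas_lt _ (Filter.Eventually.of_forall hg0) hg.aemeasurable,
    ← Ioc_union_Ioi_eq_Ioi hc0.le,
    lintegral_union measurableSet_Ioi (disjoint_left.2 fun x hx hx' => not_lt.2 hx.2 hx')]
  calc _ ≤ (∫⁻ _ in Ioc 0 c, ENNReal.ofReal v) +
          ∫⁻ t in Ioi c, ENNReal.ofReal A * ENNReal.ofReal (t ^ (-1 / θ)) := by
        refine add_le_add (lintegral_mono fun t => ?_)
          (setLIntegral_mono (by fun_prop) fun t ht => ?_)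
        · rw [← hvH, ← Measure.restrict_apply_univ H]
          exact measure_mono (subset_univ _)
        · rw [← ENNReal.ofReal_mul hA.le]
          exact (Measure.restrict_apply_le _ _).trans (hw t (hc0.trans ht))
    _ = ENNReal.ofReal (v * c + A * (-c ^ (-1 / θ + 1) / (-1 / θ + 1))) := by
        have : 0 ≤ -c ^ (-1 / θ + 1) / (-1 / θ + 1) :=
          div_nonneg_of_nonpos (neg_nonpos.2 (by positivity)) (by linarith)
        rw [setLIntegral_const, lintegral_const_mul _ (by fun_prop), setLIntegral_Ioi_rpow hs hc0,
          Real.volume_Ioc, sub_zero, ← ENNReal.ofReal_mul hv0.le, ← ENNReal.ofReal_mul hA.le,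
          ← ENNReal.ofReal_add (by positivity) (by positivity)]
    _ = ENNReal.ofReal (A ^ θ * v ^ (1 - θ) / (1 - θ)) := by
        congr 1
        rw [h1, mul_div_assoc', mul_neg, h2]
        have : -1 / θ + 1 = -((1 - θ) / θ) := by field_simp; ring
        rw [this]; field_simp; ring
    _ = _ := by
        rw [hvH, ENNReal.ofReal_rpow_of_pos hv0, ← ENNReal.ofReal_mul hK.le]
        congr 1; ring

theorem setLIntegral_norm_sub_rpow_le {E : Type*} [NormedAddCommGroup E] [NormedSpace ℝ E]
    [MeasurableSpace E] [BorelSpace E] [FiniteDimensional ℝ E] [Nontrivial E]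
    (μ : Measure E) [μ.IsAddHaarMeasure] {d α : ℝ} (hd : d = Module.finrank ℝ E)
    (hα : 0 < α) (hαd : α < d) (x : E) (H : Set E) :
    ∫⁻ y in H, ENNReal.ofReal (‖x - y‖ ^ (α - d)) ∂μ ≤
      ENNReal.ofReal (d / α * (μ (Metric.ball 0 1)).toReal ^ ((d - α) / d)) * μ H ^ (α / d) := by
  have hd0 : 0 < d := hα.trans hαd
  have hb : μ (Metric.ball (0 : E) 1) ≠ ⊤ := measure_ball_lt_top.ne
  have hA : 0 < (μ (Metric.ball (0 : E) 1)).toReal :=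
    ENNReal.toReal_pos (Metric.measure_ball_pos _ _ one_pos).ne' hb
  have h := setLIntegral_le_of_weak_type (μ := μ) (g := fun y => ‖x - y‖ ^ (α - d))
    (by fun_prop) (fun y => by positivity) hA (θ := (d - α) / d) (by apply div_pos <;> linarith)
    (by rw [div_lt_one hd0]; linarith) (fun c hc => ?_) H
  · have e1 : 1 - (d - α) / d = α / d := by field_simp; ring
    rw [e1] at h
    convert h using 3
    field_simp
  · have hs : α - d < 0 := by linarith
    have hsub : {y | c < ‖x - y‖ ^ (α - d)} ⊆ Metric.ball x (c ^ (α - d)⁻¹) := by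
      intro y hy
      have hy' : c < ‖x - y‖ ^ (α - d) := hy
      have h0 : 0 < ‖x - y‖ := by
        rcases (norm_nonneg (x - y)).eq_or_lt with h0 | h0
        · rw [← h0, Real.zero_rpow hs.ne] at hy'; linarith
        · exact h0
      rw [Metric.mem_ball, dist_comm, dist_eq_norm]
      exact (Real.lt_rpow_inv_iff_of_neg h0 hc hs).2 hy'
    refine (measure_mono hsub).trans_eq ?_
    rw [Measure.addHaar_ball μ x (by positivity), ENNReal.ofReal_mul hA.le,
      ENNReal.ofReal_toReal hb, mul_comm, ← Real.rpow_natCast, ← hd, ← Real.rpow_mul hc.le]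
    congr 3
    have : d - α ≠ 0 := by linarith
    have : α - d ≠ 0 := by linarith
    field_simp
    ring

/-- Bounding an `L^r` norm by duality with nonnegative real functions. -/
theorem lintegral_rpow_le_of_forall_lintegral_mul_le {X : Type*} [MeasurableSpace X]
    {μ : Measure X} [SigmaFinite μ] {F : X → ℝ≥0∞} {r q : ℝ} {C : ℝ≥0∞}
    (hrq : r.HolderConjugate q)
    (hC : ∀ h : X → ℝ, Measurable h → (∀ x, 0 ≤ h x) → ∫⁻ x, ENNReal.ofReal (h x ^ q) ∂μ ≤ 1 →
      ∫⁻ x, F x * ENNReal.ofReal (h x) ∂μ ≤ C) :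
    ∫⁻ x, F x ^ r ∂μ ≤ C ^ r := by
  by_contra! hlt
  obtain ⟨φ, hφF, hφ⟩ : ∃ φ : SimpleFunc X NNReal, (∀ x, (φ x : ℝ≥0∞) ≤ F x ^ r) ∧
      C ^ r < ∫⁻ x, φ x ∂μ := by
    simp_rw [lintegral_eq_nnreal (fun x => F x ^ r), lt_iSup_iff] at hlt
    obtain ⟨φ, hφF, hφ⟩ := hlt
    refine ⟨φ, hφF, ?_⟩
    rwa [← SimpleFunc.lintegral_eq_lintegral] at hφ
  obtain ⟨g, hgφ, hg_top, hg_lt⟩ :=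
    SimpleFunc.exists_lt_lintegral_simpleFunc_of_lt_lintegral hφ
  have hgF (x : X) : (g x : ℝ≥0∞) ≤ F x ^ r := (ENNReal.coe_le_coe.2 (hgφ x)).trans (hφF x)
  have hr0 : 0 < r := hrq.pos
  have hq0 : 0 < q := hrq.symm.pos
  set N : ℝ := (∫⁻ x, g x ∂μ).toReal with hN
  have hN0 : 0 < N := ENNReal.toReal_pos (bot_le.trans_lt hg_lt).ne' hg_top.ne
  have hNg : ∫⁻ x, g x ∂μ = ENNReal.ofReal N := (ENNReal.ofReal_toReal hg_top.ne).symm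
  have hgm : Measurable fun x => (g x : ℝ) := g.measurable.coe_nnreal_real
  have key := hC (fun x => ((g x : ℝ) / N) ^ q⁻¹) (by fun_prop) (fun x => by positivity) ?_
  · refine absurd hg_lt (not_lt.2 ?_)
    rw [hNg]
    have h1 : ENNReal.ofReal (N ^ r⁻¹) ≤ C := by
      refine le_trans ?_ key
      calc ENNReal.ofReal (N ^ r⁻¹) = (∫⁻ x, g x ∂μ) * ENNReal.ofReal (N ^ (-q⁻¹)) := by
            rw [hNg, ← ENNReal.ofReal_mul hN0.le]
            nth_rewrite 2 [← Real.rpow_one N]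
            rw [← Real.rpow_add hN0]
            congr 2
            linarith [hrq.inv_add_inv_eq_one]
        _ = ∫⁻ x, g x * ENNReal.ofReal (N ^ (-q⁻¹)) ∂μ := by
            rw [lintegral_mul_const _ (by fun_prop)]
        _ ≤ _ := by
            refine lintegral_mono fun x => ?_
            rw [Real.div_rpow (by positivity) hN0.le, div_eq_mul_inv, ← Real.rpow_neg hN0.le,
              ENNReal.ofReal_mul (by positivity), ← mul_assoc]
            gcongr
            calc (g x : ℝ≥0∞) = (g x : ℝ≥0∞) ^ r⁻¹ * (g x : ℝ≥0∞) ^ q⁻¹ := by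
                  rw [← ENNReal.rpow_add_of_nonneg _ _ (by positivity) (by positivity),
                    hrq.inv_add_inv_eq_one, ENNReal.rpow_one]
              _ ≤ F x * ENNReal.ofReal ((g x : ℝ) ^ q⁻¹) := by
                  gcongr
                  · rw [ENNReal.rpow_inv_le_iff hr0]; exact hgF x
                  · rw [← ENNReal.ofReal_rpow_of_nonneg (by positivity) (by positivity)]
                    simp
    calc ENNReal.ofReal N = ENNReal.ofReal (N ^ r⁻¹) ^ r := by
          rw [ENNReal.ofReal_rpow_of_nonneg (by positivity) hr0.le, ← Real.rpow_mul hN0.le,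
            inv_mul_cancel₀ hr0.ne', Real.rpow_one]
      _ ≤ C ^ r := by gcongr
  · calc _ = ∫⁻ x, g x * ENNReal.ofReal N⁻¹ ∂μ := by
          refine lintegral_congr fun x => ?_
          rw [← Real.rpow_mul (by positivity), inv_mul_cancel₀ hq0.ne', Real.rpow_one,
            div_eq_mul_inv, ENNReal.ofReal_mul (by positivity)]
          simp
      _ = 1 := by
          rw [lintegral_mul_const _ (by fun_prop), hNg, ← ENNReal.ofReal_mul hN0.le,
            mul_inv_cancel₀ hN0.ne', ENNReal.ofReal_one]
      _ ≤ 1 := le_rfl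

/-- The Riesz potential of a nonnegative function that is normalised in `L^p`. -/
theorem lintegral_riesz_kernel_rpow_le {n : ℕ} (hn : 1 ≤ n) {p r α : ℝ} (hp : 1 < p)
    (hα : 0 < α) (hαp : α < (n : ℝ) / p) (hr : 1 / r = 1 / p - α / (n : ℝ))
    {f : EuclideanSpace ℝ (Fin n) → ℝ} (hf : Measurable f) (hf0 : ∀ x, 0 ≤ f x)
    (hf1 : ∫⁻ x, ENNReal.ofReal (f x ^ p) ≤ 1) :
    ∫⁻ x, (∫⁻ y, ENNReal.ofReal (‖x - y‖ ^ (α - n)) * ENNReal.ofReal (f y)) ^ r ≤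
      ENNReal.ofReal (3 * p * r / (p - 1) * (p / r) ^ (1 / p - 1 / r) * ((n:ℝ) / α) *
        ((volume (Metric.ball (0 : EuclideanSpace ℝ (Fin n)) 1)).toReal)
          ^ (((n:ℝ) - α) / (n:ℝ))) ^ r := by
  have hn0 : (0 : ℝ) < n := by exact_mod_cast hn
  have hp0 : 0 < p := by linarith
  have : Nonempty (Fin n) := ⟨⟨0, hn⟩⟩
  have hαp' : α / n < 1 / p := by rw [div_lt_div_iff₀ hn0 hp0]; rw [lt_div_iff₀ hp0] at hαp; linarith
  have hp1 : 1 / p < 1 := by rw [div_lt_one hp0]; exact hp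
  have hαn : α < n := by rw [← div_lt_one hn0]; linarith
  set δ := α / n with hδ
  have hδ0 : 0 < δ := by positivity
  have hr0 : 0 < r := by rw [← one_div_pos, hr]; linarith
  have hpr : p < r := by rw [← one_div_lt_one_div hr0 hp0, hr]; linarith
  have hrq : r.HolderConjugate (r / (r - 1)) := Real.HolderConjugate.conjExponent (by linarith)
  set q := r / (r - 1) with hq
  have hqr : 1 / q = 1 - 1 / r := by
    have := hrq.inv_add_inv_eq_one
    simp only [one_div]; linarith
  have hpq : 1 / q + 1 / p = 1 + δ := by rw [hqr, hr]; ring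
  have hq1 : 1 < q := hrq.symm.lt
  set K := (n : ℝ) / α * ((volume (Metric.ball (0 : EuclideanSpace ℝ (Fin n)) 1)).toReal)
          ^ (((n:ℝ) - α) / (n:ℝ)) with hK
  have hK0 : 0 ≤ K := by positivity
  refine lintegral_rpow_le_of_forall_lintegral_mul_le hrq fun h hh hh0 hh1 => ?_
  have hker (x : EuclideanSpace ℝ (Fin n)) (H : Set (EuclideanSpace ℝ (Fin n))) :
      ∫⁻ y in H, ENNReal.ofReal (‖x - y‖ ^ (α - n)) ≤ ENNReal.ofReal K * volume H ^ δ :=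
    setLIntegral_norm_sub_rpow_le volume (by simp) hα hαn x H
  have hD1 : 1 - p * δ = p / r := by
    have : δ = 1 / p - 1 / r := by linarith
    rw [this]; field_simp; ring
  have hD2 : 1 - q * δ = q * ((p - 1) / p) := by
    have : δ = 1 / q + 1 / p - 1 := by linarith
    rw [this]; field_simp; ring
  have hδ1 : 1 / p - 1 / r = δ := by linarith
  refine (lintegral_lintegral_kernel_le hh hh0 hf hf0
    (k := fun x y => ENNReal.ofReal (‖x - y‖ ^ (α - n))) (by unfold Function.uncurry; fun_prop)
    hq1 hp hδ0 hpq (fun x H _ => hker x H) (fun y E _ => ?_) hh1 hf1).trans ?_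
  · simp_rw [norm_sub_rev _ y]; exact hker y E
  · have hp1' : 0 < p - 1 := by linarith
    have hP : 1 ≤ p / (p - 1) := by rw [one_le_div hp1']; linarith
    have hpr0 : 0 < p / r := by positivity
    have hpr1 : p / r ≤ (p / r) ^ δ :=
      Real.self_le_rpow_of_le_one hpr0.le (by rw [div_le_one hr0]; exact hpr.le) (by linarith)
    have b1 : ((1 - δ) / (1 - p * δ)) ^ (1 - δ) ≤ r / p * (p / r) ^ δ := by
      rw [hD1]
      calc ((1 - δ) / (p / r)) ^ (1 - δ) ≤ (1 / (p / r)) ^ (1 - δ) := by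
            have : 0 ≤ 1 - δ := by linarith
            gcongr; linarith
        _ = _ := by
            rw [one_div, Real.inv_rpow hpr0.le, Real.rpow_sub hpr0, Real.rpow_one]
            field_simp
    have b2 : ((1 - δ) / (1 - q * δ)) ^ (1 - δ) ≤ p / (p - 1) := by
      rw [hD2]
      calc ((1 - δ) / (q * ((p - 1) / p))) ^ (1 - δ) ≤ (p / (p - 1)) ^ (1 - δ) := by
            have : 0 ≤ 1 - δ := by linarith
            have h4 : 0 < (p - 1) / p := by positivity
            have h5 : (1 - δ) / (q * ((p - 1) / p)) ≤ p / (p - 1) := by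
              rw [← one_div_div (p - 1) p]
              gcongr
              · linarith
              · nlinarith
            gcongr
        _ ≤ p / (p - 1) := by
            conv_rhs => rw [← Real.rpow_one (p / (p - 1))]
            exact Real.rpow_le_rpow_of_exponent_le hP (by linarith)
    have hD10 : 0 ≤ ((1 - δ) / (1 - p * δ)) ^ (1 - δ) := by
      rw [hD1]; exact Real.rpow_nonneg (div_nonneg (by linarith) hpr0.le) _
    have hD20 : 0 ≤ ((1 - δ) / (1 - q * δ)) ^ (1 - δ) := by
      rw [hD2]; exact Real.rpow_nonneg (div_nonneg (by linarith) (by positivity)) _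
    rw [← ENNReal.ofReal_add hD10 hD20, ← ENNReal.ofReal_mul hK0]
    refine ENNReal.ofReal_le_ofReal ?_
    rw [hδ1, mul_assoc _ ((n : ℝ) / α), mul_comm]
    refine mul_le_mul_of_nonneg_right ?_ hK0
    refine (add_le_add b1 b2).trans ?_
    set z := (p / r) ^ δ with hz
    have hz0 : 0 < z := by positivity
    have e1 : p / (p - 1) ≤ p / (p - 1) * r * z := by
      have : 1 ≤ r * z := by
        have := mul_le_mul_of_nonneg_left hpr1 hr0.le
        rw [mul_div_cancel₀ _ hr0.ne'] at this
        linarith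
      rw [mul_assoc]
      exact le_mul_of_one_le_right (by positivity) this
    have e2 : r / p * z ≤ p / (p - 1) * r * z := by
      gcongr
      rw [div_le_iff₀ hp0]
      have : 1 ≤ p / (p - 1) * p := one_le_mul_of_one_le_of_one_le hP hp.le
      nlinarith
    have e3 : 3 * p * r / (p - 1) * z = 3 * (p / (p - 1) * r * z) := by ring
    have e4 : 0 ≤ p / (p - 1) * r * z := by positivity
    linarith

/-- **Hardy–Littlewood–Sobolev theorem** with explicit constant: for `1 < p < ∞`,
`0 < α < n/p`, `1/r = 1/p - α/n`, and `A` the volume of the unit ball of ℝⁿ,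
if `f ∈ L^p(ℝⁿ)` then `I_α f ∈ L^r(ℝⁿ)` and `‖I_α f‖_r ≤ C ‖f‖_p` where
`C = (3 p r/(p-1)) (p/r)^{1/p-1/r} (n/α) A^{(n-α)/n}`. -/
theorem hardy_littlewood_sobolev (n : ℕ) (hn : 1 ≤ n)
    (p r α : ℝ) (hp : 1 < p)
    (hα : 0 < α) (hαp : α < (n:ℝ) / p)
    (hr : 1 / r = 1 / p - α / (n:ℝ))
    (f : EuclideanSpace ℝ (Fin n) → ℝ) (hf : Measurable f)
    (hfL : lpNorm volume f p < ⊤) :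
    lpNorm volume (riesz n α f) r < ⊤ ∧
      lpNorm volume (riesz n α f) r ≤
        ENNReal.ofReal (3 * p * r / (p - 1) * (p / r) ^ (1 / p - 1 / r) *
            ((n:ℝ) / α) *
            ((volume (Metric.ball (0 : EuclideanSpace ℝ (Fin n)) 1)).toReal)
              ^ (((n:ℝ) - α) / (n:ℝ))) *
          lpNorm volume f p := by
  have hp0 : 0 < p := by linarith
  have hn0 : (0 : ℝ) < n := by exact_mod_cast hn
  have hr0 : 0 < r := by
    rw [← one_div_pos, hr, sub_pos, div_lt_div_iff₀ hn0 hp0]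
    rw [lt_div_iff₀ hp0] at hαp
    linarith
  set C := 3 * p * r / (p - 1) * (p / r) ^ (1 / p - 1 / r) * ((n:ℝ) / α) *
    ((volume (Metric.ball (0 : EuclideanSpace ℝ (Fin n)) 1)).toReal) ^ (((n:ℝ) - α) / (n:ℝ))
    with hC
  have hle (N : ℝ) (hN0 : 0 < N) (hN : lpNorm volume f p ≤ ENNReal.ofReal N) :
      lpNorm volume (riesz n α f) r ≤ ENNReal.ofReal C * ENNReal.ofReal N := by
    have hg1 : ∫⁻ x, ENNReal.ofReal ((|f x| / N) ^ p) ≤ 1 := by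
      rw [_root_.lpNorm, one_div, ENNReal.rpow_inv_le_iff hp0] at hN
      have h1 : ENNReal.ofReal N ^ p ≠ 0 := (ENNReal.rpow_pos (by simpa using hN0) (by simp)).ne'
      have h2 : ENNReal.ofReal N ^ p ≠ ⊤ := ENNReal.rpow_ne_top_of_nonneg hp0.le (by simp)
      calc _ = ∫⁻ x, ENNReal.ofReal |f x| ^ p * (ENNReal.ofReal N ^ p)⁻¹ := by
            refine lintegral_congr fun x => ?_
            rw [← ENNReal.ofReal_rpow_of_nonneg (by positivity) hp0.le,
              ENNReal.ofReal_div_of_pos hN0, ENNReal.div_rpow_of_nonneg _ _ hp0.le,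
              div_eq_mul_inv]
        _ ≤ ENNReal.ofReal N ^ p * (ENNReal.ofReal N ^ p)⁻¹ := by
            rw [lintegral_mul_const _ (by fun_prop)]
            gcongr
        _ = 1 := ENNReal.mul_inv_cancel h1 h2
    have key := lintegral_riesz_kernel_rpow_le hn hp hα hαp hr (f := fun x => |f x| / N)
      (by fun_prop) (fun x => by positivity) hg1
    rw [_root_.lpNorm, one_div, ENNReal.rpow_inv_le_iff hr0, mul_comm,
      ENNReal.mul_rpow_of_nonneg _ _ hr0.le]
    refine le_trans ?_ (mul_le_mul_right key _)
    rw [← lintegral_const_mul' _ _ (ENNReal.rpow_ne_top_of_nonneg hr0.le (by simp))]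
    refine lintegral_mono fun x => ?_
    rw [← ENNReal.mul_rpow_of_nonneg _ _ hr0.le, ← lintegral_const_mul' _ _ (by simp)]
    gcongr
    rw [riesz, ← Real.norm_eq_abs, ofReal_norm]
    refine (enorm_integral_le_lintegral_enorm _).trans (lintegral_mono fun y => ?_)
    rw [enorm_mul, Real.enorm_of_nonneg (by positivity), mul_left_comm,
      ← ENNReal.ofReal_mul hN0.le, mul_div_cancel₀ _ hN0.ne', Real.enorm_eq_ofReal_abs]
  have hmain : lpNorm volume (riesz n α f) r ≤ ENNReal.ofReal C * lpNorm volume f p := by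
    set M := (lpNorm volume f p).toReal with hM
    have hfM : lpNorm volume f p = ENNReal.ofReal M := (ENNReal.ofReal_toReal hfL.ne).symm
    have hlim : Filter.Tendsto (fun N : ℝ => ENNReal.ofReal C * ENNReal.ofReal N)
        (nhdsWithin M (Ioi M)) (nhds (ENNReal.ofReal C * ENNReal.ofReal M)) :=
      ((ENNReal.continuous_const_mul ENNReal.ofReal_ne_top).comp
        ENNReal.continuous_ofReal).continuousWithinAt
    rw [hfM]
    refine ge_of_tendsto hlim ?_
    filter_upwards [self_mem_nhdsWithin] with N hN
    exact hle N (ENNReal.toReal_nonneg.trans_lt hN)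
      (hfM.trans_le (ENNReal.ofReal_le_ofReal (le_of_lt hN)))
  exact ⟨hmain.trans_lt (ENNReal.mul_lt_top ENNReal.ofReal_lt_top hfL), hmain⟩
end

section
/- Let u and v be nonnegative, nonincreasing, locally integrable functions on (0,∞), set U(s) = (1/s)∫₀^s u(τ) dτ and V(s) = (1/s)∫₀^s v(τ) dτ, and let t > 0 be such that ∫_t^∞ U(s) V(s) ds < ∞. Then ∫_t^∞ U(s) v(s) ds ≤ −t U(t) V(t) + ∫_t^∞ U(s) V(s) ds, and consequently t U(t) V(t) + ∫_t^∞ u(s) v(s) ds ≤ ∫_t^∞ U(s) V(s) ds. -/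
open MeasureTheory Set

open Filter Topology

/-- The average of `f` over the interval `(0, s]`. -/
noncomputable def average₀ (f : ℝ → ℝ) (s : ℝ) : ℝ := (1 / s) * ∫ τ in Set.Ioc (0:ℝ) s, f τ

section Average

variable {f g : ℝ → ℝ} {a b s t : ℝ}

lemma average₀_nonneg (hf : ∀ s ∈ Ioi (0:ℝ), 0 ≤ f s) (hs : 0 < s) : 0 ≤ average₀ f s :=
  mul_nonneg (by positivity) (setIntegral_nonneg measurableSet_Ioc fun x hx => hf x hx.1)

lemma mul_average₀ (hs : 0 < s) : s * average₀ f s = ∫ τ in Ioc (0:ℝ) s, f τ := by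
  rw [average₀]
  field_simp

lemma mul_average₀_mono (hf : ∀ s ∈ Ioi (0:ℝ), 0 ≤ f s)
    (hfi : ∀ s > (0:ℝ), IntegrableOn f (Ioc 0 s)) (ha : 0 < a) (hab : a ≤ b) :
    a * average₀ f a ≤ b * average₀ f b := by
  rw [mul_average₀ ha, mul_average₀ (ha.trans_le hab)]
  refine setIntegral_mono_set (hfi b (ha.trans_le hab)) ?_ (Ioc_subset_Ioc_right hab).eventuallyLE
  filter_upwards [ae_restrict_mem measurableSet_Ioc] with x hx using hf x hx.1

lemma le_average₀ (hf : AntitoneOn f (Ioi 0)) (hfi : ∀ s > (0:ℝ), IntegrableOn f (Ioc 0 s))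
    (hs : 0 < s) : f s ≤ average₀ f s := by
  have h : ∫ _ in Ioc (0:ℝ) s, f s ≤ ∫ τ in Ioc (0:ℝ) s, f τ :=
    setIntegral_mono_on (integrableOn_const (by simp)) (hfi s hs) measurableSet_Ioc
      fun x hx => hf hx.1 hs hx.2
  rw [← mul_average₀ (f := f) hs] at h
  simp only [setIntegral_const, smul_eq_mul, Real.volume_real_Ioc_of_le hs.le, sub_zero] at h
  exact le_of_mul_le_mul_left h hs

lemma average₀_eq_intervalIntegral (hs : 0 < s) :
    average₀ f s = s⁻¹ * ∫ τ in (0:ℝ)..s, f τ := by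
  rw [average₀, one_div, intervalIntegral.integral_of_le hs.le]

lemma continuousOn_average₀ (hfi : ∀ s > (0:ℝ), IntegrableOn f (Ioc 0 s)) :
    ContinuousOn (average₀ f) (Ioi 0) := by
  refine ContinuousOn.congr (f := fun s => s⁻¹ * ∫ τ in (0:ℝ)..s, f τ) ?_
    fun s hs => average₀_eq_intervalIntegral hs
  have hinv : ContinuousOn (fun s : ℝ => s⁻¹) (Ioi 0) :=
    continuousOn_inv₀.mono fun x hx => (ne_of_gt hx : x ≠ 0)
  refine hinv.mul fun s hs => ?_
  have hs0 : (0:ℝ) < s := hs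
  have hc := intervalIntegral.continuousOn_primitive_interval' (μ := volume) (f := f)
    ((intervalIntegrable_iff_integrableOn_Ioc_of_le (by positivity)).2 (hfi (s + 1) (by positivity)))
    (left_mem_uIcc (a := (0:ℝ)) (b := s + 1))
  rw [uIcc_of_le (by positivity)] at hc
  exact (hc.continuousAt (Icc_mem_nhds hs0 (lt_add_one s))).continuousWithinAt

lemma hasDerivAt_average₀ (hf : AntitoneOn f (Ioi 0))
    (hfi : ∀ s > (0:ℝ), IntegrableOn f (Ioc 0 s)) (hs : 0 < s) (hc : ContinuousAt f s) :
    HasDerivAt (average₀ f) ((f s - average₀ f s) / s) s := by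
  have hm : StronglyMeasurableAtFilter f (𝓝 s) :=
    ⟨Ioi 0, Ioi_mem_nhds hs,
      (aemeasurable_restrict_of_antitoneOn measurableSet_Ioi hf).aestronglyMeasurable⟩
  have hd := intervalIntegral.integral_hasDerivAt_right
    ((intervalIntegrable_iff_integrableOn_Ioc_of_le hs.le).2 (hfi s hs)) hm hc
  have h := (hasDerivAt_inv hs.ne').mul hd
  refine (h.congr_of_eventuallyEq ?_).congr_deriv ?_
  · filter_upwards [Ioi_mem_nhds hs] with x hx using average₀_eq_intervalIntegral hx
  · rw [average₀_eq_intervalIntegral hs]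
    field_simp
    ring

lemma intervalIntegrable_of_pos (hfi : ∀ s > (0:ℝ), IntegrableOn f (Ioc 0 s)) (ha : 0 < a)
    (hab : a ≤ b) : IntervalIntegrable f volume a b :=
  (intervalIntegrable_iff_integrableOn_Ioc_of_le hab).2
    ((hfi b (ha.trans_le hab)).mono_set (Ioc_subset_Ioc_left ha.le))

lemma intervalIntegrable_of_continuousOn_pos (hf : ContinuousOn f (Ioi 0)) (ha : 0 < a)
    (hab : a ≤ b) : IntervalIntegrable f volume a b := by
  refine (hf.mono fun x hx => ?_).intervalIntegrable
  rw [uIcc_of_le hab] at hx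
  exact ha.trans_le hx.1

lemma intervalIntegrable_deriv_average₀ (hfi : ∀ s > (0:ℝ), IntegrableOn f (Ioc 0 s))
    (ha : 0 < a) (hab : a ≤ b) :
    IntervalIntegrable (fun s => (f s - average₀ f s) / s) volume a b := by
  have h := (intervalIntegrable_of_pos hfi ha hab).sub
    (intervalIntegrable_of_continuousOn_pos (continuousOn_average₀ hfi) ha hab)
  simp only [div_eq_mul_inv]
  refine h.mul_continuousOn (continuousOn_inv₀.mono fun x hx => ?_)
  rw [uIcc_of_le hab] at hx
  exact (ha.trans_le hx.1).ne'

lemma integral_deriv_average₀ (hf : AntitoneOn f (Ioi 0))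
    (hfi : ∀ s > (0:ℝ), IntegrableOn f (Ioc 0 s)) (ha : 0 < a) (hab : a ≤ b) :
    ∫ s in a..b, (f s - average₀ f s) / s = average₀ f b - average₀ f a := by
  have hsub : Icc a b ⊆ Ioi 0 := fun x hx => ha.trans_le hx.1
  refine integral_eq_of_hasDerivAt_off_countable_of_le _ _ hab hf.countable_not_continuousWithinAt
    ((continuousOn_average₀ hfi).mono hsub) (fun x hx => ?_)
    (intervalIntegrable_deriv_average₀ hfi ha hab)
  have hx0 : 0 < x := ha.trans hx.1.1
  have hc : ContinuousWithinAt f (Ioi 0) x := by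
    by_contra h
    exact hx.2 ⟨hx0, h⟩
  exact hasDerivAt_average₀ hf hfi hx0 (hc.continuousAt (Ioi_mem_nhds hx0))

lemma antitoneOn_average₀ (hf : AntitoneOn f (Ioi 0))
    (hfi : ∀ s > (0:ℝ), IntegrableOn f (Ioc 0 s)) : AntitoneOn (average₀ f) (Ioi 0) := by
  intro a ha b _ hab
  rw [← sub_nonneg, ← neg_sub, ← integral_deriv_average₀ hf hfi ha hab,
    ← intervalIntegral.integral_neg]
  refine intervalIntegral.integral_nonneg hab fun x hx => ?_
  have hx0 : 0 < x := lt_of_lt_of_le ha hx.1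
  rw [← neg_div, neg_sub]
  exact div_nonneg (sub_nonneg.2 (le_average₀ hf hfi hx0)) hx0.le

lemma intervalIntegral_average₀_mul_le (hf0 : ∀ s ∈ Ioi (0:ℝ), 0 ≤ f s)
    (hg : AntitoneOn g (Ioi 0)) (hfi : ∀ s > (0:ℝ), IntegrableOn f (Ioc 0 s))
    (hgi : ∀ s > (0:ℝ), IntegrableOn g (Ioc 0 s)) (ha : 0 < a) (hab : a ≤ b) :
    ∫ s in a..b, average₀ f s * g s ≤ -(a * average₀ f a * average₀ g a) +
      (∫ s in a..b, average₀ f s * average₀ g s) + a * average₀ f a * average₀ g b := by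
  have hfc := continuousOn_average₀ hfi
  have hI := intervalIntegrable_of_continuousOn_pos (hfc.mul (continuousOn_average₀ hgi)) ha hab
  have hD := (intervalIntegrable_deriv_average₀ hgi ha hab).const_mul (a * average₀ f a)
  have hsub : uIcc a b ⊆ Ioi 0 := by
    rw [uIcc_of_le hab]
    exact fun x hx => ha.trans_le hx.1
  have hle := intervalIntegral.integral_mono_on hab
    ((intervalIntegrable_of_pos hgi ha hab).continuousOn_mul (hfc.mono hsub)) (hI.add hD)
    fun s hs => by
      have hs0 : 0 < s := ha.trans_le hs.1
      have h1 := mul_le_mul_of_nonneg_right (mul_average₀_mono hf0 hfi ha hs.1)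
        (div_nonneg (sub_nonneg.2 (le_average₀ hg hgi hs0)) hs0.le)
      have h2 : s * average₀ f s * ((average₀ g s - g s) / s) =
          average₀ f s * (average₀ g s - g s) := by field_simp
      have h3 : a * average₀ f a * ((g s - average₀ g s) / s) =
          -(a * average₀ f a * ((average₀ g s - g s) / s)) := by ring
      change _ ≤ average₀ f s * average₀ g s + a * average₀ f a * ((g s - average₀ g s) / s)
      linarith
  have hadd := intervalIntegral.integral_add hI hD
  rw [intervalIntegral.integral_const_mul, integral_deriv_average₀ hg hgi ha hab] at hadd
  simp only [Pi.mul_apply] at hle hadd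
  linarith

lemma tendsto_mul_average₀ (hf0 : ∀ s ∈ Ioi (0:ℝ), 0 ≤ f s) (hg0 : ∀ s ∈ Ioi (0:ℝ), 0 ≤ g s)
    (hg : AntitoneOn g (Ioi 0)) (hfi : ∀ s > (0:ℝ), IntegrableOn f (Ioc 0 s))
    (hgi : ∀ s > (0:ℝ), IntegrableOn g (Ioc 0 s)) (ht : 0 < t)
    (hfg : IntegrableOn (fun s => average₀ f s * average₀ g s) (Ioi t)) :
    Tendsto (fun T => t * average₀ f t * average₀ g T) atTop (𝓝 0) := by
  have hlog : Tendsto (fun T => Real.log (T / t)) atTop atTop :=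
    Real.tendsto_log_atTop.comp (tendsto_id.atTop_div_const ht)
  refine squeeze_zero' ?_ ?_
    (hlog.const_div_atTop (∫ s in Ioi t, average₀ f s * average₀ g s))
  · filter_upwards [eventually_gt_atTop t] with T hT
    exact mul_nonneg (mul_nonneg ht.le (average₀_nonneg hf0 ht))
      (average₀_nonneg hg0 (ht.trans hT))
  · filter_upwards [eventually_gt_atTop t] with T hT
    have hT0 : 0 < T := ht.trans hT
    rw [le_div_iff₀ (Real.log_pos ((one_lt_div ht).2 hT)), ← integral_inv_of_pos ht hT0,
      ← intervalIntegral.integral_const_mul, intervalIntegral.integral_of_le hT.le]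
    have hinv : IntegrableOn (fun s : ℝ => t * average₀ f t * average₀ g T * s⁻¹) (Ioc t T) :=
      (intervalIntegrable_iff_integrableOn_Ioc_of_le hT.le).1
        (intervalIntegrable_of_continuousOn_pos
          (continuousOn_const.mul (continuousOn_inv₀.mono fun x hx => (ne_of_gt hx : x ≠ 0)))
          ht hT.le)
    refine (setIntegral_mono_on hinv (hfg.mono_set Ioc_subset_Ioi_self) measurableSet_Ioc
      fun s hs => ?_).trans (setIntegral_mono_set hfg ?_ Ioc_subset_Ioi_self.eventuallyLE)
    · have hs0 : 0 < s := ht.trans hs.1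
      have h := mul_le_mul (mul_average₀_mono hf0 hfi ht hs.1.le)
        (antitoneOn_average₀ hg hgi hs0 hT0 hs.2) (average₀_nonneg hg0 hT0)
        (mul_nonneg hs0.le (average₀_nonneg hf0 hs0))
      rw [← div_eq_mul_inv, div_le_iff₀ hs0]
      linarith
    · filter_upwards [ae_restrict_mem measurableSet_Ioi] with s hs
      have hs0 : 0 < s := ht.trans hs
      exact mul_nonneg (average₀_nonneg hf0 hs0) (average₀_nonneg hg0 hs0)

end Average

/-- If `u, v` are nonnegative, nonincreasing and integrable on `(0,s)` for all
`s > 0`, `U(s) = (1/s)∫₀^s u`, `V(s) = (1/s)∫₀^s v`, `t > 0` and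
`∫_t^∞ U V < ∞`, then `∫_t^∞ U(s) v(s) ds ≤ -t U(t) V(t) + ∫_t^∞ U(s) V(s) ds`
and consequently `t U(t) V(t) + ∫_t^∞ u(s) v(s) ds ≤ ∫_t^∞ U(s) V(s) ds`. -/
theorem integral_Uv_le (u v : ℝ → ℝ)
    (hu0 : ∀ s ∈ Set.Ioi (0:ℝ), 0 ≤ u s) (hv0 : ∀ s ∈ Set.Ioi (0:ℝ), 0 ≤ v s)
    (humono : AntitoneOn u (Set.Ioi (0:ℝ))) (hvmono : AntitoneOn v (Set.Ioi (0:ℝ)))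
    (huint : ∀ s > (0:ℝ), IntegrableOn u (Set.Ioc 0 s) volume)
    (hvint : ∀ s > (0:ℝ), IntegrableOn v (Set.Ioc 0 s) volume)
    (U V : ℝ → ℝ)
    (hU : ∀ s, U s = (1 / s) * ∫ τ in Set.Ioc (0:ℝ) s, u τ)
    (hV : ∀ s, V s = (1 / s) * ∫ τ in Set.Ioc (0:ℝ) s, v τ)
    (t : ℝ) (ht : 0 < t)
    (hfin : ∫⁻ s in Set.Ioi t, ENNReal.ofReal (U s * V s) < ⊤) :
    (∫ s in Set.Ioi t, U s * v s) ≤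
        -(t * U t * V t) + ∫ s in Set.Ioi t, U s * V s ∧
      t * U t * V t + (∫ s in Set.Ioi t, u s * v s) ≤
        ∫ s in Set.Ioi t, U s * V s := by
  obtain rfl : U = average₀ u := funext hU
  obtain rfl : V = average₀ v := funext hV
  have hUc := continuousOn_average₀ huint
  have hVc := continuousOn_average₀ hvint
  have hsub : Ioi t ⊆ Ioi (0:ℝ) := Ioi_subset_Ioi ht.le
  have hUV0 : ∀ s ∈ Ioi (0:ℝ), 0 ≤ average₀ u s * average₀ v s := fun s hs =>
    mul_nonneg (average₀_nonneg hu0 hs) (average₀_nonneg hv0 hs)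
  have hUV : IntegrableOn (fun s => average₀ u s * average₀ v s) (Ioi t) := by
    refine ⟨((hUc.mul hVc).mono hsub).aestronglyMeasurable measurableSet_Ioi, ?_⟩
    rw [hasFiniteIntegral_iff_ofReal]
    · exact hfin
    · filter_upwards [ae_restrict_mem measurableSet_Ioi] with s hs using hUV0 s (hsub hs)
  have hvm : AEStronglyMeasurable v (volume.restrict (Ioi t)) :=
    (aemeasurable_restrict_of_antitoneOn measurableSet_Ioi (hvmono.mono hsub)).aestronglyMeasurable
  have hUm : AEStronglyMeasurable (average₀ u) (volume.restrict (Ioi t)) :=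
    (hUc.mono hsub).aestronglyMeasurable measurableSet_Ioi
  have hUv : IntegrableOn (fun s => average₀ u s * v s) (Ioi t) := by
    refine Integrable.mono' hUV (hUm.mul hvm) ?_
    filter_upwards [ae_restrict_mem measurableSet_Ioi] with s hs
    have hs0 := hsub hs
    rw [Real.norm_of_nonneg (mul_nonneg (average₀_nonneg hu0 hs0) (hv0 s hs0))]
    exact mul_le_mul_of_nonneg_left (le_average₀ hvmono hvint hs0) (average₀_nonneg hu0 hs0)
  have key : (∫ s in Ioi t, average₀ u s * v s) ≤
      -(t * average₀ u t * average₀ v t) + ∫ s in Ioi t, average₀ u s * average₀ v s := by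
    have h1 := intervalIntegral_tendsto_integral_Ioi t hUv tendsto_id
    have h2 := intervalIntegral_tendsto_integral_Ioi t hUV tendsto_id
    have h3 : Tendsto (fun T => t * average₀ u t * average₀ v T) atTop (𝓝 0) :=
      tendsto_mul_average₀ hu0 hv0 hvmono huint hvint ht hUV
    have h4 := (h2.const_add (-(t * average₀ u t * average₀ v t))).add h3
    rw [add_zero] at h4
    refine le_of_tendsto_of_tendsto h1 h4 ?_
    filter_upwards [eventually_ge_atTop t] with T hT
    exact intervalIntegral_average₀_mul_le hu0 hvmono huint hvint ht hT
  refine ⟨key, ?_⟩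
  have hle : (∫ s in Ioi t, u s * v s) ≤ ∫ s in Ioi t, average₀ u s * v s := by
    refine integral_mono_of_nonneg ?_ hUv ?_
    · filter_upwards [ae_restrict_mem measurableSet_Ioi] with s hs
      exact mul_nonneg (hu0 s (hsub hs)) (hv0 s (hsub hs))
    · filter_upwards [ae_restrict_mem measurableSet_Ioi] with s hs
      exact mul_le_mul_of_nonneg_right (le_average₀ humono huint (hsub hs)) (hv0 s (hsub hs))
  linarith
end

section
/- Real-variable core of the generalized Young inequality: let F and G be nonnegative, nonincreasing, measurable functions on (0,∞); let 1 ≤ p₁, p₂ < ∞ with 1/p₁ + 1/p₂ > 1 and define p₀ by 1/p₁ + 1/p₂ − 1 = 1/p₀; let 1 ≤ q₁, q₂, q₀ < ∞ satisfy 1/q₁ + 1/q₂ ≥ 1/q₀. Then (∫₀^∞ (t^{1/p₀} ∫_t^∞ F(s) G(s) ds)^{q₀} dt/t)^{1/q₀} ≤ 3 p₀ (∫₀^∞ (t^{1/p₁} F(t))^{q₁} dt/t)^{1/q₁} · (∫₀^∞ (t^{1/p₂} G(t))^{q₂} dt/t)^{1/q₂}. -/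
open MeasureTheory Set
open scoped ENNReal

lemma lintegral_Ioo_rpow_sub_one {b t : ℝ} (hb : 0 < b) (ht : 0 < t) :
    ∫⁻ s in Ioo 0 t, ENNReal.ofReal (s ^ (b - 1)) = ENNReal.ofReal (t ^ b / b) := by
  have hi : IntegrableOn (fun s : ℝ => s ^ (b - 1)) (Ioc 0 t) :=
    (intervalIntegrable_iff_integrableOn_Ioc_of_le ht.le).1
      (intervalIntegral.intervalIntegrable_rpow' (by linarith))
  rw [setLIntegral_congr Ioo_ae_eq_Ioc, ← ofReal_integral_eq_lintegral_ofReal hi,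
    ← intervalIntegral.integral_of_le ht.le, integral_rpow (Or.inl (by linarith))]
  · simp [Real.zero_rpow hb.ne']
  · filter_upwards [ae_restrict_mem measurableSet_Ioc] with s hs
    exact Real.rpow_nonneg hs.1.le _

lemma lintegral_Ioi_rpow_neg_sub_one {a t : ℝ} (ha : 0 < a) (ht : 0 < t) :
    ∫⁻ s in Ioi t, ENNReal.ofReal (s ^ (-a - 1)) = ENNReal.ofReal (t ^ (-a) / a) := by
  rw [← ofReal_integral_eq_lintegral_ofReal (integrableOn_Ioi_rpow_of_lt (by linarith) ht),
    integral_Ioi_rpow_of_lt (by linarith) ht]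
  · rw [sub_add_cancel, neg_div_neg_eq]
  · filter_upwards [ae_restrict_mem measurableSet_Ioi] with s hs
    exact Real.rpow_nonneg (ht.trans hs).le _

/-- **Jensen's inequality** for powers, with respect to a probability density. -/
lemma rpow_lintegral_mul_le_of_lintegral_eq_one {α : Type*} [MeasurableSpace α] (μ : Measure α)
    {w h : α → ℝ≥0∞} (hw : Measurable w) (hw1 : ∫⁻ x, w x ∂μ = 1) (hh : Measurable h)
    {q : ℝ} (hq : 1 ≤ q) :
    (∫⁻ x, w x * h x ∂μ) ^ q ≤ ∫⁻ x, w x * h x ^ q ∂μ := by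
  have : IsProbabilityMeasure (μ.withDensity w) :=
    ⟨by rw [withDensity_apply _ MeasurableSet.univ, Measure.restrict_univ, hw1]⟩
  have key := eLpNorm'_le_eLpNorm'_of_exponent_le one_pos hq (μ.withDensity w)
    hh.aestronglyMeasurable
  simp only [eLpNorm', enorm_eq_self, ENNReal.rpow_one, div_one] at key
  rw [lintegral_withDensity_eq_lintegral_mul _ hw hh,
    lintegral_withDensity_eq_lintegral_mul _ hw (hh.pow_const q), one_div] at key
  exact (ENNReal.le_rpow_inv_iff (by linarith)).1 key

/-- **Hardy's inequality** for the averages over `(t, ∞)` against the probability density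
`a t ^ a s ^ (-a - 1)`. -/
lemma lintegral_rpow_lintegral_Ioi_le {a q : ℝ} (ha : 0 < a) (hq : 1 ≤ q) {h : ℝ → ℝ≥0∞}
    (hh : Measurable h) :
    ∫⁻ t in Ioi (0:ℝ), (∫⁻ s in Ioi t, ENNReal.ofReal (a * t ^ a * s ^ (-a - 1)) * h s) ^ q
        * (ENNReal.ofReal t)⁻¹
      ≤ ∫⁻ s in Ioi (0:ℝ), h s ^ q * (ENNReal.ofReal s)⁻¹ := by
  calc
    _ ≤ ∫⁻ t in Ioi (0:ℝ), ∫⁻ s in Ioi (0:ℝ), (Iio s).indicator (fun t =>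
          ENNReal.ofReal (a * s ^ (-a - 1)) * h s ^ q * ENNReal.ofReal (t ^ (a - 1))) t := by
      refine setLIntegral_mono' measurableSet_Ioi fun t ht => ?_
      have ht : 0 < t := ht
      have hw : Measurable fun s : ℝ => ENNReal.ofReal (a * t ^ a * s ^ (-a - 1)) := by fun_prop
      have hw1 : ∫⁻ s in Ioi t, ENNReal.ofReal (a * t ^ a * s ^ (-a - 1)) = 1 := by
        have hpos : 0 ≤ a * t ^ a := by positivity
        simp_rw [ENNReal.ofReal_mul hpos]
        rw [lintegral_const_mul _ (by fun_prop), lintegral_Ioi_rpow_neg_sub_one ha ht,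
          ← ENNReal.ofReal_mul hpos, Real.rpow_neg ht.le, ← ENNReal.ofReal_one]
        congr 1
        field_simp
      calc
        _ ≤ (∫⁻ s in Ioi t, ENNReal.ofReal (a * t ^ a * s ^ (-a - 1)) * h s ^ q)
              * (ENNReal.ofReal t)⁻¹ := by
          gcongr
          exact rpow_lintegral_mul_le_of_lintegral_eq_one _ hw hw1 hh hq
        _ = ∫⁻ s in Ioi t,
              ENNReal.ofReal (a * s ^ (-a - 1)) * h s ^ q * ENNReal.ofReal (t ^ (a - 1)) := by
          rw [← lintegral_mul_const _ (by fun_prop)]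
          refine setLIntegral_congr_fun measurableSet_Ioi fun s hs => ?_
          have hs : 0 < s := ht.trans hs
          have e : a * t ^ a * s ^ (-a - 1) = a * s ^ (-a - 1) * (t ^ (a - 1) * t) := by
            rw [← Real.rpow_add_one ht.ne', sub_add_cancel]; ring
          have h0 : ENNReal.ofReal t ≠ 0 := by simpa using ht
          rw [e, ENNReal.ofReal_mul (p := a * s ^ (-a - 1)) (by positivity),
            ENNReal.ofReal_mul (q := t) (by positivity),
            ← ENNReal.mul_inv_cancel_right (a := ENNReal.ofReal (a * s ^ (-a - 1)) * h s ^ q *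
              ENNReal.ofReal (t ^ (a - 1))) h0 ENNReal.ofReal_ne_top]
          ring
        _ = ∫⁻ s in Ioi (0:ℝ), (Ioi t).indicator (fun s =>
              ENNReal.ofReal (a * s ^ (-a - 1)) * h s ^ q * ENNReal.ofReal (t ^ (a - 1))) s := by
          rw [setLIntegral_indicator measurableSet_Ioi,
            inter_eq_left.2 (Ioi_subset_Ioi ht.le)]
        _ = _ := by
          simp only [indicator, mem_Ioi, mem_Iio]
    _ = ∫⁻ s in Ioi (0:ℝ), ∫⁻ t in Ioi (0:ℝ), (Iio s).indicator (fun t =>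
          ENNReal.ofReal (a * s ^ (-a - 1)) * h s ^ q * ENNReal.ofReal (t ^ (a - 1))) t := by
      refine lintegral_lintegral_swap (Measurable.aemeasurable ?_)
      have hset : MeasurableSet {x : ℝ × ℝ | x.1 < x.2} :=
        measurableSet_lt measurable_fst measurable_snd
      have hm : Measurable fun x : ℝ × ℝ => ENNReal.ofReal (a * x.2 ^ (-a - 1)) * h x.2 ^ q *
          ENNReal.ofReal (x.1 ^ (a - 1)) := by fun_prop
      exact hm.indicator hset
    _ = _ := by
      refine setLIntegral_congr_fun measurableSet_Ioi fun s hs => ?_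
      have hs : 0 < s := hs
      rw [setLIntegral_indicator measurableSet_Iio, Iio_inter_Ioi,
        lintegral_const_mul _ (by fun_prop), lintegral_Ioo_rpow_sub_one ha hs,
        ← ENNReal.ofReal_inv_of_pos hs, mul_right_comm, ← ENNReal.ofReal_mul (by positivity),
        mul_comm]
      congr 2
      rw [sub_eq_add_neg, Real.rpow_add hs, Real.rpow_neg hs.le, Real.rpow_neg_one]
      field_simp

/-- Pointwise bound of a nonincreasing function by its Lorentz functional. -/
lemma AntitoneOn.rpow_mul_le_lintegral {F : ℝ → ℝ≥0∞} (hF : AntitoneOn F (Ioi 0))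
    {a q t : ℝ} (ha : 0 < a) (ha1 : a ≤ 1) (hq : 1 ≤ q) (ht : 0 < t) :
    ENNReal.ofReal t ^ a * F t ≤ ENNReal.ofReal (Real.exp (1 / 2)) *
      (∫⁻ s in Ioi (0:ℝ), (ENNReal.ofReal s ^ a * F s) ^ q * (ENNReal.ofReal s)⁻¹) ^ (1 / q) := by
  have hq0 : 0 < q := by linarith
  have haq : 0 < a * q := by positivity
  have hlow : F t ^ q * ENNReal.ofReal (t ^ (a * q) / (a * q)) ≤
      ∫⁻ s in Ioi (0:ℝ), (ENNReal.ofReal s ^ a * F s) ^ q * (ENNReal.ofReal s)⁻¹ := by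
    rw [← lintegral_Ioo_rpow_sub_one haq ht, ← lintegral_const_mul _ (by fun_prop)]
    refine (setLIntegral_mono' measurableSet_Ioo fun s hs => ?_).trans
      (lintegral_mono_set Ioo_subset_Ioi_self)
    have hs0 : 0 < s := hs.1
    rw [ENNReal.mul_rpow_of_nonneg _ _ hq0.le, ← ENNReal.rpow_mul,
      ENNReal.ofReal_rpow_of_pos hs0, ← ENNReal.ofReal_inv_of_pos hs0, mul_right_comm,
      ← ENNReal.ofReal_mul (by positivity), ← Real.rpow_neg_one, ← Real.rpow_add hs0,
      ← sub_eq_add_neg, mul_comm]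
    gcongr
    exact hF hs0 ht hs.2.le
  have hexp : a * q ≤ Real.exp (1 / 2) ^ q := by
    rw [← Real.exp_mul]
    have := Real.quadratic_le_exp_of_nonneg (x := 1 / 2 * q) (by positivity)
    nlinarith [sq_nonneg (q - 2)]
  rw [← ENNReal.rpow_le_rpow_iff hq0, ENNReal.mul_rpow_of_nonneg _ _ hq0.le,
    ENNReal.mul_rpow_of_nonneg _ _ hq0.le, ← ENNReal.rpow_mul, ← ENNReal.rpow_mul,
    one_div_mul_cancel hq0.ne', ENNReal.rpow_one, ENNReal.ofReal_rpow_of_pos ht,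
    ENNReal.ofReal_rpow_of_pos (Real.exp_pos _)]
  calc
    _ = ENNReal.ofReal (a * q) * (F t ^ q * ENNReal.ofReal (t ^ (a * q) / (a * q))) := by
      rw [mul_left_comm, ← ENNReal.ofReal_mul haq.le, mul_div_cancel₀ _ haq.ne', mul_comm]
    _ ≤ _ := by gcongr

/-- **Hölder's inequality** with surplus integrability, for functions bounded by a multiple of
their `L^q` norms. -/
lemma lintegral_mul_rpow_le_of_ae_le {α : Type*} [MeasurableSpace α] (μ : Measure α)
    {f g : α → ℝ≥0∞} (hf : AEMeasurable f μ) (hg : AEMeasurable g μ) {q₀ q₁ q₂ : ℝ}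
    (hq₀ : 0 < q₀) (hq₁ : 0 < q₁) (hq₂ : 0 < q₂) (hqq : 1 / q₀ ≤ 1 / q₁ + 1 / q₂)
    {c : ℝ≥0∞} (hc : 1 ≤ c)
    (hfc : ∀ᵐ x ∂μ, f x ≤ c * (∫⁻ x, f x ^ q₁ ∂μ) ^ (1 / q₁))
    (hgc : ∀ᵐ x ∂μ, g x ≤ c * (∫⁻ x, g x ^ q₂ ∂μ) ^ (1 / q₂)) :
    (∫⁻ x, (f x * g x) ^ q₀ ∂μ) ^ (1 / q₀) ≤
      c ^ 2 * ((∫⁻ x, f x ^ q₁ ∂μ) ^ (1 / q₁) * (∫⁻ x, g x ^ q₂ ∂μ) ^ (1 / q₂)) := by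
  obtain ⟨r, hr, hrq⟩ : ∃ r : ℝ, 0 < r ∧ 1 / r = 1 / q₁ + 1 / q₂ :=
    ⟨1 / (1 / q₁ + 1 / q₂), by positivity, by rw [one_div_one_div]⟩
  have hrq₀ : r ≤ q₀ := (one_div_le_one_div hq₀ hr).1 (hrq ▸ hqq)
  have hrq₁ : r < q₁ := by
    refine (one_div_lt_one_div hq₁ hr).1 ?_
    rw [hrq]
    linarith [one_div_pos.2 hq₂]
  have holder := ENNReal.lintegral_Lp_mul_le_Lq_mul_Lr hr hrq₁ hrq μ hf hg
  set A := (∫⁻ x, f x ^ q₁ ∂μ) ^ (1 / q₁)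
  set B := (∫⁻ x, g x ^ q₂ ∂μ) ^ (1 / q₂)
  have hc2 : 1 ≤ c ^ 2 := one_le_pow₀ hc
  have holder' : ∫⁻ x, (f x * g x) ^ r ∂μ ≤ (c ^ 2 * (A * B)) ^ r := by
    rw [one_div, ENNReal.rpow_inv_le_iff hr] at holder
    refine holder.trans ?_
    exact ENNReal.rpow_le_rpow (le_mul_of_one_le_left' hc2) hr.le
  rw [one_div, ENNReal.rpow_inv_le_iff hq₀]
  calc
    ∫⁻ x, (f x * g x) ^ q₀ ∂μ
      ≤ ∫⁻ x, (c ^ 2 * (A * B)) ^ (q₀ - r) * (f x * g x) ^ r ∂μ := by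
        refine lintegral_mono_ae ?_
        filter_upwards [hfc, hgc] with x hfx hgx
        have hx : f x * g x ≤ c ^ 2 * (A * B) := (mul_le_mul' hfx hgx).trans_eq (by ring)
        calc
          (f x * g x) ^ q₀ = (f x * g x) ^ (q₀ - r) * (f x * g x) ^ r := by
            rw [← ENNReal.rpow_add_of_nonneg _ _ (sub_nonneg.2 hrq₀) hr.le, sub_add_cancel]
          _ ≤ _ := by
            gcongr
    _ = (c ^ 2 * (A * B)) ^ (q₀ - r) * ∫⁻ x, (f x * g x) ^ r ∂μ :=
        lintegral_const_mul'' _ (by fun_prop)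
    _ ≤ (c ^ 2 * (A * B)) ^ (q₀ - r) * (c ^ 2 * (A * B)) ^ r := by gcongr
    _ = (c ^ 2 * (A * B)) ^ q₀ := by
        rw [← ENNReal.rpow_add_of_nonneg _ _ (sub_nonneg.2 hrq₀) hr.le, sub_add_cancel]

/-- **Real-variable core of the generalized Young inequality**: for nonnegative
nonincreasing measurable `F, G` on `(0,∞)`, `1 ≤ p₁, p₂ < ∞` with
`1/p₁ + 1/p₂ > 1`, `1/p₁ + 1/p₂ - 1 = 1/p₀`, and `1 ≤ q₁, q₂, q₀ < ∞` with
`1/q₁ + 1/q₂ ≥ 1/q₀`,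
`(∫₀^∞ (t^{1/p₀} ∫_t^∞ F G)^{q₀} dt/t)^{1/q₀}
  ≤ 3 p₀ (∫₀^∞ (t^{1/p₁} F(t))^{q₁} dt/t)^{1/q₁} (∫₀^∞ (t^{1/p₂} G(t))^{q₂} dt/t)^{1/q₂}`. -/
theorem young_inequality_core (F G : ℝ → ℝ≥0∞)
    (hF : Measurable F) (hG : Measurable G)
    (hFmono : AntitoneOn F (Set.Ioi (0:ℝ))) (hGmono : AntitoneOn G (Set.Ioi (0:ℝ)))
    (p₁ p₂ p₀ q₁ q₂ q₀ : ℝ)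
    (hp₁ : 1 ≤ p₁) (hp₂ : 1 ≤ p₂)
    (hpp : 1 / p₁ + 1 / p₂ > 1)
    (hp₀ : 1 / p₁ + 1 / p₂ - 1 = 1 / p₀)
    (hq₁ : 1 ≤ q₁) (hq₂ : 1 ≤ q₂) (hq₀ : 1 ≤ q₀)
    (hqq : 1 / q₁ + 1 / q₂ ≥ 1 / q₀) :
    (∫⁻ t in Set.Ioi (0:ℝ),
        (ENNReal.ofReal t ^ (1 / p₀) * ∫⁻ s in Set.Ioi t, F s * G s) ^ q₀
          * (ENNReal.ofReal t)⁻¹) ^ (1 / q₀)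
      ≤ ENNReal.ofReal (3 * p₀) *
          (∫⁻ t in Set.Ioi (0:ℝ),
            (ENNReal.ofReal t ^ (1 / p₁) * F t) ^ q₁ * (ENNReal.ofReal t)⁻¹) ^ (1 / q₁) *
          (∫⁻ t in Set.Ioi (0:ℝ),
            (ENNReal.ofReal t ^ (1 / p₂) * G t) ^ q₂ * (ENNReal.ofReal t)⁻¹) ^ (1 / q₂) := by
  have ha₁ : 0 < 1 / p₁ := by positivity
  have ha₂ : 0 < 1 / p₂ := by positivity
  have ha₁' : 1 / p₁ ≤ 1 := (div_le_one (by linarith)).2 hp₁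
  have ha₂' : 1 / p₂ ≤ 1 := (div_le_one (by linarith)).2 hp₂
  have ha : 0 < 1 / p₀ := by linarith
  have hp₀_pos : 0 < p₀ := one_div_pos.1 ha
  have hq₀_pos : 0 < q₀ := by linarith
  set f : ℝ → ℝ≥0∞ := fun t => ENNReal.ofReal t ^ (1 / p₁) * F t with hf
  set g : ℝ → ℝ≥0∞ := fun t => ENNReal.ofReal t ^ (1 / p₂) * G t with hg
  have hfm : Measurable f := by fun_prop
  have hgm : Measurable g := by fun_prop
  set μ : Measure ℝ :=
    (volume.restrict (Ioi (0:ℝ))).withDensity fun t => (ENNReal.ofReal t)⁻¹ with hμ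
  have hint {u : ℝ → ℝ≥0∞} (hu : Measurable u) :
      ∫⁻ t in Ioi (0:ℝ), u t * (ENNReal.ofReal t)⁻¹ = ∫⁻ t, u t ∂μ := by
    rw [hμ, lintegral_withDensity_eq_lintegral_mul _ (by fun_prop) hu]
    simp only [Pi.mul_apply, mul_comm]
  have hae {P : ℝ → Prop} (hP : ∀ t, 0 < t → P t) : ∀ᵐ t ∂μ, P t :=
    (withDensity_absolutelyContinuous _ _).ae_le
      ((ae_restrict_mem measurableSet_Ioi).mono hP)
  have hexp : ENNReal.ofReal (Real.exp (1 / 2)) ^ 2 ≤ ENNReal.ofReal 3 := by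
    rw [← ENNReal.ofReal_pow (Real.exp_pos _).le, ← Real.exp_nat_mul]
    refine ENNReal.ofReal_le_ofReal ?_
    norm_num
    linarith [Real.exp_one_lt_d9]
  have hprod := lintegral_mul_rpow_le_of_ae_le μ (q₀ := q₀) hfm.aemeasurable hgm.aemeasurable
    hq₀_pos (by linarith) (by linarith) hqq
    (c := ENNReal.ofReal (Real.exp (1 / 2)))
    (by rw [← ENNReal.ofReal_one]; exact ENNReal.ofReal_le_ofReal (Real.one_le_exp (by norm_num)))
    (hae fun t ht => by
      rw [← hint (hfm.pow_const q₁)]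
      exact hFmono.rpow_mul_le_lintegral ha₁ ha₁' hq₁ ht)
    (hae fun t ht => by
      rw [← hint (hgm.pow_const q₂)]
      exact hGmono.rpow_mul_le_lintegral ha₂ ha₂' hq₂ ht)
  rw [← hint (hfm.pow_const q₁), ← hint (hgm.pow_const q₂),
    ← hint (u := fun t => (f t * g t) ^ q₀) (by fun_prop)] at hprod
  have htail (t : ℝ) (ht : 0 < t) :
      ENNReal.ofReal t ^ (1 / p₀) * ∫⁻ s in Ioi t, F s * G s =
        ENNReal.ofReal p₀ * ∫⁻ s in Ioi t,
          ENNReal.ofReal (1 / p₀ * t ^ (1 / p₀) * s ^ (-(1 / p₀) - 1)) * (f s * g s) := by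
    rw [ENNReal.ofReal_rpow_of_pos ht, ← lintegral_const_mul _ (by fun_prop),
      ← lintegral_const_mul _ (by fun_prop)]
    refine setLIntegral_congr_fun measurableSet_Ioi fun s hs => ?_
    have hs : 0 < s := ht.trans hs
    have e : t ^ (1 / p₀) =
        p₀ * (1 / p₀ * t ^ (1 / p₀) * s ^ (-(1 / p₀) - 1)) * s ^ (1 / p₁) * s ^ (1 / p₂) := by
      have : s ^ (-(1 / p₀) - 1) * s ^ (1 / p₁) * s ^ (1 / p₂) = 1 := by
        rw [← Real.rpow_add hs, ← Real.rpow_add hs, ← hp₀]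
        ring_nf
        exact Real.rpow_zero s
      linear_combination (-t ^ (1 / p₀)) * this +
        (-t ^ (1 / p₀) * (s ^ (-(1 / p₀) - 1) * s ^ (1 / p₁) * s ^ (1 / p₂))) *
          (mul_one_div_cancel hp₀_pos.ne')
    simp only [hf, hg, ENNReal.ofReal_rpow_of_pos hs]
    conv_lhs => rw [e]
    rw [ENNReal.ofReal_mul (by positivity), ENNReal.ofReal_mul (by positivity),
      ENNReal.ofReal_mul hp₀_pos.le]
    ring
  calc
    _ = (∫⁻ t in Ioi (0:ℝ), ENNReal.ofReal p₀ ^ q₀ * ((∫⁻ s in Ioi t,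
          ENNReal.ofReal (1 / p₀ * t ^ (1 / p₀) * s ^ (-(1 / p₀) - 1)) * (f s * g s)) ^ q₀ *
            (ENNReal.ofReal t)⁻¹)) ^ (1 / q₀) := by
      congr 1
      refine setLIntegral_congr_fun measurableSet_Ioi fun t ht => ?_
      rw [htail t ht, ENNReal.mul_rpow_of_nonneg _ _ hq₀_pos.le, mul_assoc]
    _ ≤ (ENNReal.ofReal p₀ ^ q₀ * ∫⁻ t in Ioi (0:ℝ),
          (f t * g t) ^ q₀ * (ENNReal.ofReal t)⁻¹) ^ (1 / q₀) := by
      rw [lintegral_const_mul' _ _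
        (ENNReal.rpow_ne_top_of_nonneg hq₀_pos.le ENNReal.ofReal_ne_top)]
      exact ENNReal.rpow_le_rpow (mul_le_mul' le_rfl
        (lintegral_rpow_lintegral_Ioi_le ha hq₀ (hfm.mul hgm))) (by positivity)
    _ = ENNReal.ofReal p₀ * (∫⁻ t in Ioi (0:ℝ),
          (f t * g t) ^ q₀ * (ENNReal.ofReal t)⁻¹) ^ (1 / q₀) := by
      rw [ENNReal.mul_rpow_of_nonneg _ _ (by positivity), ← ENNReal.rpow_mul,
        mul_one_div_cancel hq₀_pos.ne', ENNReal.rpow_one]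
    _ ≤ _ := by
      rw [mul_comm 3 p₀, ENNReal.ofReal_mul hp₀_pos.le, mul_assoc, mul_assoc]
      gcongr
      exact hprod.trans (by gcongr)
end
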